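/- arXiv:2305.12026 — 3 statements merged into one kernel-verified Lean document; each statement's English description precedes it below -/
import Mathlib

section
/- If d is even and γ₁,…,γ_d is an irreducible representation of the Clifford relations (by 2^{d/2}×2^{d/2} matrices), then the Clifford spectrum Λ(γ₁,…,γ_d) equals {0}. -/
open scoped Kronecker Matrix

section CliffAux

variable {R : Type*} [Ring R] [Algebra ℂ R] {d : ℕ}

/-- Simultaneous eigenvectors of commuting involutions. -/
lemma cliff_joint (A : Fin d → R) (hA : ∀ j, A j * A j = 1)
    (hc : ∀ j k, A j * A k = A k * A j) (X : R) (hX : X ≠ 0) (s : Finset (Fin d)) :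
    ∃ (B : R) (ε : Fin d → ℤ), (∀ Z : R, (∀ j, Z * A j = A j * Z) → Z * B = B * Z) ∧
      B * X ≠ 0 ∧ (∀ j, ε j = 1 ∨ ε j = -1) ∧
      ∀ j ∈ s, A j * (B * X) = (ε j : ℂ) • (B * X) := by
  induction s using Finset.induction_on with
  | empty => exact ⟨1, fun _ => 1, by simp, by simpa using hX, by simp, by simp⟩
  | insert a s ha ih =>
    obtain ⟨B, ε, hB, hne, hε, hs⟩ := ih
    by_cases h : B * X + A a * (B * X) = 0
    · refine ⟨B, Function.update ε a (-1), hB, hne, ?_, ?_⟩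
      · intro j
        by_cases hj : j = a
        · subst hj; simp
        · simpa [hj] using hε j
      · intro j hj
        by_cases hja : j = a
        · subst hja
          simp only [Function.update_self]
          rw [eq_neg_of_add_eq_zero_right h]; simp
        · rw [Finset.mem_insert] at hj
          simpa [hja] using hs j (hj.resolve_left hja)
    · have e : (1 + A a) * B * X = B * X + A a * (B * X) := by noncomm_ring
      refine ⟨(1 + A a) * B, Function.update ε a 1, ?_, ?_, ?_, ?_⟩
      · intro Z hZ
        rw [← mul_assoc, mul_assoc (1 + A a) B, ← hB Z hZ, ← mul_assoc, mul_add, hZ a]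
        noncomm_ring
      · rwa [e]
      · intro j
        by_cases hj : j = a
        · subst hj; simp
        · simpa [hj] using hε j
      · intro j hj
        rw [e]
        by_cases hja : j = a
        · subst hja
          simp only [Function.update_self]
          rw [mul_add, ← mul_assoc (A j) (A j), hA]
          simp [add_comm]
        · rw [Finset.mem_insert] at hj
          have := hs j (hj.resolve_left hja)
          simp only [Function.update_of_ne hja]
          rw [mul_add, ← mul_assoc (A j) (A a), hc j a, mul_assoc (A a), this]
          simp [smul_add]

lemma cliff_anti (a b : Fin d → R) (hab : ∀ j k, a j * b k = b k * a j)
    (hb : ∀ j k, b k * b j + b j * b k = if j = k then 2 else 0) (l : Fin d → ℂ) :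
    (∑ k, l k • b k) * (∑ j, a j * b j) + (∑ j, a j * b j) * (∑ k, l k • b k)
      = 2 * ∑ j, l j • a j := by
  rw [Finset.sum_mul_sum, Finset.sum_mul_sum, Finset.sum_comm, ← Finset.sum_add_distrib,
    Finset.mul_sum]
  refine Finset.sum_congr rfl fun j _ => ?_
  rw [← Finset.sum_add_distrib]
  have : ∀ k, l k • b k * (a j * b j) + a j * b j * l k • b k
      = if j = k then l k • (a j * 2) else 0 := by
    intro k
    have h1 : b k * (a j * b j) = a j * (b k * b j) := by
      rw [← mul_assoc, ← hab, mul_assoc]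
    rw [smul_mul_assoc, mul_smul_comm, h1, mul_assoc, ← smul_add, ← mul_add, hb]
    split_ifs <;> simp
  rw [Finset.sum_congr rfl fun k _ => this k]
  simp [mul_two, two_mul]

lemma cliff_sq (b : Fin d → R)
    (hb : ∀ j k, b k * b j + b j * b k = if j = k then 2 else 0) (l : Fin d → ℂ) :
    (∑ k, l k • b k) * (∑ k, l k • b k) = (∑ k, l k ^ 2) • (1 : R) := by
  have h2 : (2 : ℂ) • ((∑ k, l k • b k) * (∑ k, l k • b k)) = (2 : ℂ) • ((∑ k, l k ^ 2) • (1 : R)) := by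
    rw [two_smul]
    have hs := Finset.sum_mul_sum Finset.univ Finset.univ (fun k => l k • b k) (fun k => l k • b k)
    have hs2 := hs.trans Finset.sum_comm
    refine (congrArg₂ (· + ·) hs2 hs).trans ?_
    rw [← Finset.sum_add_distrib, Finset.sum_smul, Finset.smul_sum]
    refine Finset.sum_congr rfl fun j _ => ?_
    rw [← Finset.sum_add_distrib]
    have : ∀ k, l k • b k * l j • b j + l j • b j * l k • b k
        = if j = k then (l k * l j) • (2 : R) else 0 := by
      intro k
      rw [smul_mul_smul_comm, smul_mul_smul_comm, mul_comm (l j), ← smul_add, hb]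
      split_ifs <;> simp
    rw [Finset.sum_congr rfl fun k _ => this k]
    simp only [Finset.sum_ite_eq, Finset.mem_univ, if_true]
    rw [← one_add_one_eq_two (R := R), smul_add, two_smul, pow_two]
  exact smul_right_injective R (two_ne_zero (α := ℂ)) h2

lemma cliff_even (hd : Even d) (ε : Fin d → ℤ) (hε : ∀ j, ε j = 1 ∨ ε j = -1) :
    Even (∑ j, ε j) := by
  have h : Even (∑ j, (ε j + 1)) := by
    apply Finset.even_sum
    intro j _
    rcases hε j with h | h <;> rw [h] <;> decide
  rw [Finset.sum_add_distrib] at h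
  have h' : Even (∑ j : Fin d, (1 : ℤ)) := by simpa using hd
  exact (Int.even_add.mp h).mpr h'

lemma cliff_Acomm (a b : Fin d → R) (hab : ∀ j k, a j * b k = b k * a j)
    (haa : ∀ j k, j ≠ k → a j * a k = -(a k * a j))
    (hbb : ∀ j k, j ≠ k → b j * b k = -(b k * b j)) (j k : Fin d) :
    a j * b j * (a k * b k) = a k * b k * (a j * b j) := by
  by_cases h : j = k
  · rw [h]
  · calc a j * b j * (a k * b k) = a j * (b j * a k) * b k := by noncomm_ring
      _ = a j * (a k * b j) * b k := by rw [hab]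
      _ = (a j * a k) * (b j * b k) := by noncomm_ring
      _ = (a k * a j) * (b k * b j) := by rw [haa j k h, hbb j k h]; noncomm_ring
      _ = a k * (a j * b k) * b j := by noncomm_ring
      _ = a k * (b k * a j) * b j := by rw [hab]
      _ = _ := by noncomm_ring

lemma cliff_Asq (a b : Fin d → R) (hab : ∀ j k, a j * b k = b k * a j)
    (ha : ∀ j, a j * a j = 1) (hb : ∀ j, b j * b j = 1) (j : Fin d) :
    a j * b j * (a j * b j) = 1 := by
  calc a j * b j * (a j * b j) = a j * (b j * a j) * b j := by noncomm_ring
    _ = a j * (a j * b j) * b j := by rw [hab]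
    _ = (a j * a j) * (b j * b j) := by noncomm_ring
    _ = 1 := by rw [ha, hb, one_mul]

lemma cliff_car (b : Fin d → R) (hb : ∀ j, b j * b j = 1)
    (hbb : ∀ j k, j ≠ k → b j * b k = -(b k * b j)) (j k : Fin d) :
    b k * b j + b j * b k = if j = k then 2 else 0 := by
  split_ifs with h
  · subst h; rw [hb, one_add_one_eq_two]
  · rw [hbb j k h]; simp

/-- Nonzero `lam` gives a regular element. -/
lemma cliff_regular (hd : Even d) (a b : Fin d → R) (hab : ∀ j k, a j * b k = b k * a j)
    (ha : ∀ j, a j * a j = 1) (hb : ∀ j, b j * b j = 1)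
    (haa : ∀ j k, j ≠ k → a j * a k = -(a k * a j))
    (hbb : ∀ j k, j ≠ k → b j * b k = -(b k * b j))
    (l : Fin d → ℝ) (X : R) (hX : X ≠ 0)
    (h0 : (∑ j, a j * b j) * X = (∑ j, (l j : ℂ) • b j) * X) : l = 0 := by
  have hAc := cliff_Acomm a b hab haa hbb
  obtain ⟨B, ε, hB, hne, hε, hs⟩ := cliff_joint (fun j => a j * b j)
    (cliff_Asq a b hab ha hb) hAc X hX Finset.univ
  have hVM := cliff_anti a b hab (cliff_car b hb hbb) (fun j => (l j : ℂ))
  have hUM := cliff_anti b a (fun j k => (hab k j).symm) (cliff_car a ha haa) (fun j => (l j : ℂ))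
  have hV := cliff_sq b (cliff_car b hb hbb) (fun j => (l j : ℂ))
  have hU := cliff_sq a (cliff_car a ha haa) (fun j => (l j : ℂ))
  simp only [← hab] at hUM
  have hMB : (∑ j, a j * b j) * B = B * ∑ j, a j * b j := by
    apply hB
    intro j
    rw [Finset.sum_mul, Finset.mul_sum]
    exact Finset.sum_congr rfl fun k _ => hAc k j
  have hMY : (∑ j, a j * b j) * (B * X) = ((∑ j, ε j : ℤ) : ℂ) • (B * X) := by
    rw [Finset.sum_mul, Finset.sum_congr rfl fun j _ => hs j (Finset.mem_univ j), ← Finset.sum_smul]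
    push_cast
    rfl
  have hm := cliff_even hd ε hε
  generalize (∑ j, ε j) = m at *
  generalize (∑ j, a j * b j) = M at *
  have hr : (∑ k, ((l k : ℂ)) ^ 2) = ((∑ k, l k ^ 2 : ℝ) : ℂ) := by push_cast; rfl
  rw [hr] at hV hU
  generalize hr2 : (∑ k, l k ^ 2) = r at *
  generalize (∑ j, (l j : ℂ) • b j) = V at *
  generalize (∑ j, (l j : ℂ) • a j) = U at *
  have e1 : 2 * (U * X) = (r : ℂ) • X + M * (M * X) := by
    rw [← mul_assoc, ← hVM, add_mul, mul_assoc, mul_assoc, h0, ← mul_assoc V V, hV]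
    simp
  -- v1 M M X
  have e2 : U * (M * (M * X)) = 2 * (V * (M * X)) - 2 * (M * (V * X)) + M * (M * (U * X)) := by
    have : U * M = 2 * V - M * U := eq_sub_of_add_eq hUM
    rw [← mul_assoc U M, this, sub_mul, mul_assoc M U, ← mul_assoc U M, this]
    noncomm_ring
  have e3 : V * (M * X) = (r : ℂ) • X := by rw [h0, ← mul_assoc, hV]; simp
  have e4 : U * (U * X) = (r : ℂ) • X := by rw [← mul_assoc, hU]; simp
  have e5 : (r : ℂ) • (U * X) + M * (M * (U * X)) = 2 * (M * (M * X)) := by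
    have h := congrArg (U * ·) e1
    simp only [mul_add, mul_smul_comm] at h
    rw [e2, e3, ← h0] at h
    have h' : U * (2 * (U * X)) = 2 * ((r : ℂ) • X) := by rw [← e4]; noncomm_ring
    rw [h'] at h
    have : (r : ℂ) • (U * X) + M * (M * (U * X)) - 2 * (M * (M * X)) =
      ((r : ℂ) • (U * X) + (2 * (r : ℂ) • X - 2 * (M * (M * X)) + M * (M * (U * X))))
        - 2 * ((r : ℂ) • X) := by abel
    rw [← h, sub_self] at this
    exact sub_eq_zero.mp this
  have e6 : (r : ℂ) • ((r : ℂ) • X + M * (M * X)) + M * (M * ((r : ℂ) • X + M * (M * X)))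
      = 4 * (M * (M * X)) := by
    rw [← e1]
    have : (r : ℂ) • (2 * (U * X)) + M * (M * (2 * (U * X)))
      = 2 * ((r : ℂ) • (U * X) + M * (M * (U * X))) := by
      simp only [two_mul, mul_add, smul_add]
    rw [this, e5, ← mul_assoc]; norm_num
  have hBM : ∀ Z, B * (M * Z) = M * (B * Z) := fun Z => by rw [← mul_assoc, ← hMB, mul_assoc]
  have e7 := congrArg (B * ·) e6
  have h4 : (4 : R) * (M * (M * X)) = (4 : ℂ) • (M * (M * X)) := by
    rw [ofNat_smul_eq_nsmul, nsmul_eq_mul, Nat.cast_ofNat]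
  rw [h4] at e7
  simp only [mul_add, mul_smul_comm, hBM, smul_add, hMY] at e7
  have e8 : (((r : ℂ) + (m : ℂ) ^ 2) ^ 2 - 4 * (m : ℂ) ^ 2) • (B * X) = 0 := by
    rw [← sub_eq_zero] at e7
    rw [← e7]
    module
  have e9 := (smul_eq_zero.mp e8).resolve_right hne
  have e10 : (r + (m : ℝ) ^ 2) ^ 2 - 4 * (m : ℝ) ^ 2 = 0 := by exact_mod_cast e9
  have hr0 : 0 ≤ r := by rw [← hr2]; positivity
  have hrz : r = 0 := by
    by_cases hmz : m = 0
    · subst hmz; simpa using e10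
    · obtain ⟨t, ht⟩ := hm
      have hm2 : (4 : ℤ) ≤ m ^ 2 := by
        have : t ≠ 0 := by rintro rfl; simp at ht; exact hmz ht
        have : 1 ≤ t ^ 2 := by have := sq_pos_of_ne_zero this; lia
        rw [ht]; nlinarith
      have hm2' : (4 : ℝ) ≤ (m : ℝ) ^ 2 := by exact_mod_cast hm2
      nlinarith
  rw [hrz] at hr2
  funext j
  have := (Finset.sum_eq_zero_iff_of_nonneg (fun k _ => sq_nonneg (l k))).mp hr2 j (Finset.mem_univ j)
  simpa using this

/-- The kernel at zero is nontrivial. -/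
lemma cliff_zero [Nontrivial R] (hd : Even d) (a b : Fin d → R)
    (hab : ∀ j k, a j * b k = b k * a j)
    (ha : ∀ j, a j * a j = 1) (hb : ∀ j, b j * b j = 1)
    (haa : ∀ j k, j ≠ k → a j * a k = -(a k * a j))
    (hbb : ∀ j k, j ≠ k → b j * b k = -(b k * b j)) :
    ∃ X : R, X ≠ 0 ∧ (∑ j, a j * b j) * X = 0 := by
  have key : ∀ n : ℕ, ∀ (X : R) (ε : Fin d → ℤ), X ≠ 0 → (∀ j, ε j = 1 ∨ ε j = -1) →
      (∀ j, a j * b j * X = (ε j : ℂ) • X) → (∑ j, ε j).natAbs = n →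
      ∃ X : R, X ≠ 0 ∧ (∑ j, a j * b j) * X = 0 := by
    intro n
    induction n using Nat.strong_induction_on with
    | _ n ih =>
      intro X ε hX hε hs hn
      have hev := cliff_even hd ε hε
      by_cases h0 : (∑ j, ε j) = 0
      · refine ⟨X, hX, ?_⟩
        rw [Finset.sum_mul, Finset.sum_congr rfl fun j _ => hs j, ← Finset.sum_smul]
        have : (∑ j, (ε j : ℂ)) = ((∑ j, ε j : ℤ) : ℂ) := by push_cast; rfl
        rw [this, h0]; simp
      · obtain ⟨k, hk⟩ : ∃ k, 0 < ε k * ∑ j, ε j := by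
          by_contra! hcon
          have h1 : ∑ k, ε k * ∑ j, ε j ≤ 0 := Finset.sum_nonpos fun k _ => hcon k
          rw [← Finset.sum_mul] at h1
          have := mul_self_pos.mpr h0
          lia
        let ε' : Fin d → ℤ := fun j => -ε j + if j = k then 2 * ε k else 0
        have hsum : ∑ j, ε' j = -(∑ j, ε j) + 2 * ε k := by
          simp [ε', Finset.sum_add_distrib]
        refine ih (∑ j, ε' j).natAbs ?_ (b k * X) ε' ?_ ?_ ?_ rfl
        · rw [hsum, ← hn]
          obtain ⟨t, ht⟩ := hev
          rcases hε k with h | h <;> rw [h] at hk ⊢ <;> lia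
        · intro hz
          apply hX
          have := congrArg (b k * ·) hz
          simpa [← mul_assoc, hb] using this
        · intro j
          by_cases hj : j = k
          · subst hj
            have := hε j
            simp only [ε', if_true]; lia
          · have := hε j
            simp only [ε', hj, if_false]; lia
        · intro j
          by_cases hj : j = k
          · subst hj
            have : ε' j = ε j := by simp only [ε', if_true]; ring
            rw [this, ← mul_smul_comm, ← hs j]
            rw [← mul_assoc, ← mul_assoc, hab j j, mul_assoc (b j) (a j), hab j j]
          · have : ε' j = - ε j := by simp [ε', hj]
            rw [this]
            have h2 : a j * b j * (b k * X) = -(b k * (a j * b j * X)) := by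
              calc a j * b j * (b k * X) = a j * (b j * b k) * X := by noncomm_ring
                _ = -((a j * b k) * b j * X) := by rw [hbb j k hj]; noncomm_ring
                _ = _ := by rw [hab]; noncomm_ring
            rw [h2, hs j]; simp
  obtain ⟨B, ε, hB, hne, hε, hs⟩ := cliff_joint (fun j => a j * b j)
    (cliff_Asq a b hab ha hb) (cliff_Acomm a b hab haa hbb) 1 one_ne_zero Finset.univ
  exact key _ _ ε hne hε (fun j => hs j (Finset.mem_univ j)) rfl

end CliffAux

lemma cliff_nonunit {n : Type*} [Fintype n] [DecidableEq n] (L : Matrix n n ℂ) :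
    ¬ IsUnit L ↔ ∃ X : Matrix n n ℂ, X ≠ 0 ∧ L * X = 0 := by
  constructor
  · intro h
    have hdet : L.det = 0 := by
      by_contra hne
      exact h ((Matrix.isUnit_iff_isUnit_det L).mpr (isUnit_iff_ne_zero.mpr hne))
    obtain ⟨v, hv, hLv⟩ := Matrix.exists_mulVec_eq_zero_iff.mpr hdet
    refine ⟨Matrix.of fun i _ => v i, ?_, ?_⟩
    · intro hz
      apply hv
      funext i
      exact congrFun (congrFun hz i) i
    · ext i j
      exact congrFun hLv i
  · rintro ⟨X, hX, h⟩ hu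
    exact hX ((hu.mul_right_eq_zero).mp h)

theorem clifford_spectrum_even_clifford_rep
    {d : ℕ} (hd : Even d)
    (γ : Fin d → Matrix (Fin (2 ^ (d / 2))) (Fin (2 ^ (d / 2))) ℂ)
    (hherm : ∀ j, (γ j).IsHermitian)
    (hsq : ∀ j, γ j * γ j = 1)
    (hanti : ∀ j k, j ≠ k → γ j * γ k = -(γ k * γ j)) :
    {lam : Fin d → ℝ | ¬ IsUnit (∑ j, ((γ j - (lam j : ℂ) • 1) ⊗ₖ γ j))} = {0} := by
  let I : Matrix (Fin (2 ^ (d / 2))) (Fin (2 ^ (d / 2))) ℂ := 1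
  let a := fun j => γ j ⊗ₖ I
  let b := fun j => I ⊗ₖ γ j
  have hab : ∀ j k, a j * b k = b k * a j := by
    intro j k
    simp [a, b, I, ← Matrix.mul_kronecker_mul]
  have ha : ∀ j, a j * a j = 1 := by
    intro j
    simp [a, I, ← Matrix.mul_kronecker_mul, hsq]
  have hb : ∀ j, b j * b j = 1 := by
    intro j
    simp [b, I, ← Matrix.mul_kronecker_mul, hsq]
  have haa : ∀ j k, j ≠ k → a j * a k = -(a k * a j) := by
    intro j k h
    simp only [a, I, ← Matrix.mul_kronecker_mul, hanti j k h]
    ext; simp [Matrix.kroneckerMap_apply]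
  have hbb : ∀ j k, j ≠ k → b j * b k = -(b k * b j) := by
    intro j k h
    simp only [b, I, ← Matrix.mul_kronecker_mul, hanti j k h]
    ext; simp [Matrix.kroneckerMap_apply]
  have hL : ∀ lam : Fin d → ℝ, (∑ j, ((γ j - (lam j : ℂ) • 1) ⊗ₖ γ j))
      = (∑ j, a j * b j) - ∑ j, (lam j : ℂ) • b j := by
    intro lam
    rw [← Finset.sum_sub_distrib]
    refine Finset.sum_congr rfl fun j _ => ?_
    simp only [a, b, I, ← Matrix.mul_kronecker_mul, mul_one, one_mul]
    ext ⟨i, i'⟩ ⟨k, k'⟩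
    simp [Matrix.kroneckerMap_apply, sub_mul, mul_assoc]
  ext lam
  rw [Set.mem_setOf_eq, Set.mem_singleton_iff, cliff_nonunit, hL]
  constructor
  · rintro ⟨X, hX, h⟩
    rw [sub_mul, sub_eq_zero] at h
    exact cliff_regular hd a b hab ha hb haa hbb lam X hX h
  · rintro rfl
    haveI : Nonempty (Fin (2 ^ (d / 2))) := ⟨⟨0, by positivity⟩⟩
    obtain ⟨X, hX, h⟩ := cliff_zero hd a b hab ha hb haa hbb
    exact ⟨X, hX, by simpa using h⟩
end

section
/- If d ≥ 3 is odd and γ₁,…,γ_d is an irreducible representation of the Clifford relations (with the sign convention γ_d = ε_d γ_{d-1}⋯γ₂γ₁, ε_d = i^{(d+3)/2}), then the Clifford spectrum Λ(γ₁,…,γ_d) is exactly the unit sphere S^{d-1} ⊂ ℝ^d. -/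
open scoped Kronecker Matrix

namespace CliffAux

set_option linter.unusedSectionVars false

variable {A : Type*} [Ring A] [Algebra ℂ A]

/-- joint eigenvalues of sums of commuting involutions are integers of the right parity -/
lemma eig_sum {ι : Type*} (s : ι → A) (hs : ∀ i, s i * s i = 1)
    (hc : ∀ i j, s i * s j = s j * s i) (t : Finset ι) :
    ∀ (c : ℂ) (v : A), v ≠ 0 → (∑ i ∈ t, s i) * v = c • v → ∃ k : ℤ, c = 2 * k + t.card := by
  classical
  induction t using Finset.induction_on with
  | empty =>
    intro c v hv h
    refine ⟨0, ?_⟩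
    simp only [Finset.sum_empty, zero_mul] at h
    have := (smul_eq_zero.mp h.symm).resolve_right hv
    simp [this]
  | insert i t hi ih =>
    intro c v hv h
    rw [Finset.sum_insert hi] at h
    rw [Finset.card_insert_of_notMem hi]
    have hcomm : (∑ j ∈ t, s j) * s i = s i * ∑ j ∈ t, s j := by
      rw [Finset.sum_mul, Finset.mul_sum]
      exact Finset.sum_congr rfl fun j _ => hc j i
    have hS : (∑ j ∈ t, s j) * v = c • v - s i * v := by
      rw [← h]; noncomm_ring
    have hsv : s i * (s i * v) = v := by rw [← mul_assoc, hs, one_mul]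
    have hSs : (∑ j ∈ t, s j) * (s i * v) = c • (s i * v) - v := by
      rw [← mul_assoc, hcomm, mul_assoc, hS, mul_sub, hsv, mul_smul_comm]
    by_cases hw : v + s i * v = 0
    · obtain ⟨k, hk⟩ := ih (c + 1) v hv (by
        rw [hS, eq_neg_of_add_eq_zero_right hw, add_smul, one_smul, sub_neg_eq_add])
      refine ⟨k - 1, ?_⟩
      push_cast
      linear_combination hk
    · obtain ⟨k, hk⟩ := ih (c - 1) (v + s i * v) hw (by
        rw [mul_add, hS, hSs, sub_smul, smul_add, one_smul]; abel)
      refine ⟨k, ?_⟩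
      push_cast
      linear_combination hk

section
variable {K : Type*} [Fintype K] (a b : Option (K × Bool) → A)

lemma s_sq
    (ha : ∀ i, a i * a i = 1)
    (hb : ∀ i, b i * b i = 1)
    (hab : ∀ i j, a i * b j = b j * a i)
    (i) : (a i * b i) * (a i * b i) = 1 := by
  calc (a i * b i) * (a i * b i) = a i * (b i * a i) * b i := by noncomm_ring
    _ = (a i * a i) * (b i * b i) := by rw [← hab]; noncomm_ring
    _ = 1 := by rw [ha, hb, one_mul]

lemma s_comm
    (haa : ∀ i j, i ≠ j → a i * a j = -(a j * a i))
    (hbb : ∀ i j, i ≠ j → b i * b j = -(b j * b i))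
    (hab : ∀ i j, a i * b j = b j * a i)
    (i j) : (a i * b i) * (a j * b j) = (a j * b j) * (a i * b i) := by
  by_cases h : i = j
  · rw [h]
  calc (a i * b i) * (a j * b j) = a i * (b i * a j) * b j := by noncomm_ring
    _ = (a i * a j) * (b i * b j) := by rw [← hab]; noncomm_ring
    _ = a j * (a i * b j) * b i := by rw [haa i j h, hbb i j h]; noncomm_ring
    _ = _ := by rw [hab]; noncomm_ring

lemma s_b
    (hbb : ∀ i j, i ≠ j → b i * b j = -(b j * b i))
    (hab : ∀ i j, a i * b j = b j * a i)
    (i j) (h : i ≠ j) : (a i * b i) * b j = -(b j * (a i * b i)) := by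
  rw [mul_assoc, hbb i j h, mul_neg, ← mul_assoc, hab, mul_assoc]

lemma s_b_same
    (hab : ∀ i j, a i * b j = b j * a i)
    (i) : (a i * b i) * b i = (b i * (a i * b i)) := by
  rw [← mul_assoc, hab]

lemma s_a
    (haa : ∀ i j, i ≠ j → a i * a j = -(a j * a i))
    (hab : ∀ i j, a i * b j = b j * a i)
    (i j) (h : i ≠ j) : (a i * b i) * a j = -(a j * (a i * b i)) := by
  rw [mul_assoc, ← hab, ← mul_assoc, haa i j h]; noncomm_ring

theorem part1
    (ha : ∀ i, a i * a i = 1)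
    (hb : ∀ i, b i * b i = 1)
    (haa : ∀ i j, i ≠ j → a i * a j = -(a j * a i))
    (hbb : ∀ i j, i ≠ j → b i * b j = -(b j * b i))
    (hab : ∀ i j, a i * b j = b j * a i)
    (r : ℝ) (v : A) (hv : v ≠ 0)
    (h : (∑ i, a i * b i - (r : ℂ) • b none) * v = 0) : r ^ 2 = 1 := by
  classical
  set S : A := ∑ x : K × Bool, a (some x) * b (some x) with hS
  set s := a none * b none with hs
  have hss : s * s = 1 := s_sq a b ha hb hab none
  have hsS : s * S = S * s := by
    rw [hS, Finset.sum_mul, Finset.mul_sum]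
    exact Finset.sum_congr rfl fun x _ => s_comm a b haa hbb hab _ _
  have hSb : S * b none = -(b none * S) := by
    rw [hS, Finset.sum_mul, Finset.mul_sum, ← Finset.sum_neg_distrib]
    exact Finset.sum_congr rfl fun x _ => s_b a b hbb hab _ _ (by simp)
  have hsb : s * b none = b none * s := s_b_same a b hab none
  rw [Fintype.sum_option] at h
  have key : (s - S + (r : ℂ) • b none) * (s + S - (r : ℂ) • b none)
      = 1 - S * S - ((r : ℂ) ^ 2) • (1 : A) := by
    have : (s - S + (r : ℂ) • b none) * (s + S - (r : ℂ) • b none)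
      = s * s + (s * S - S * s) - S * S - (r : ℂ) • (s * b none - b none * s)
        + (r : ℂ) • (S * b none + b none * S) - ((r : ℂ) * r) • (b none * b none) := by
      simp only [mul_add, add_mul, mul_sub, sub_mul, smul_mul_assoc, mul_smul_comm, smul_sub,
        smul_add, mul_smul]
      abel
    rw [this, hss, hsS, hsb, hSb, hb, pow_two]
    simp
  have h2 : (1 - S * S - ((r : ℂ) ^ 2) • (1 : A)) * v = 0 := by
    rw [← key, mul_assoc, h, mul_zero]
  obtain ⟨c, hc⟩ := IsAlgClosed.exists_pow_nat_eq (1 - (r : ℂ) ^ 2) (n := 2) (by norm_num)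
  have h3 : S * (S * v) = (c ^ 2) • v := by
    rw [hc, sub_smul, one_smul, ← mul_assoc]
    simp only [sub_mul, one_mul, smul_mul_assoc] at h2
    have := sub_eq_zero.mp h2
    rw [← this]; abel
  have hfin : ∃ k : ℤ, c ^ 2 = (2 * k) ^ 2 := by
    have hcard : (Finset.univ : Finset (K × Bool)).card = 2 * Fintype.card K := by
      simp [mul_comm]
    by_cases hw : S * v + c • v = 0
    · obtain ⟨k, hk⟩ := eig_sum (fun x : K × Bool => a (some x) * b (some x))
        (fun i => s_sq a b ha hb hab _) (fun i j => s_comm a b haa hbb hab _ _)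
        Finset.univ (-c) v hv (by rw [← hS, eq_neg_of_add_eq_zero_left hw, neg_smul])
      rw [hcard] at hk
      refine ⟨k + Fintype.card K, ?_⟩
      rw [← neg_sq, hk]; push_cast; ring
    · obtain ⟨k, hk⟩ := eig_sum (fun x : K × Bool => a (some x) * b (some x))
        (fun i => s_sq a b ha hb hab _) (fun i j => s_comm a b haa hbb hab _ _)
        Finset.univ c (S * v + c • v) hw (by
          rw [← hS, mul_add, h3, mul_smul_comm, smul_add, smul_smul, pow_two, add_comm])
      rw [hcard] at hk
      refine ⟨k + Fintype.card K, ?_⟩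
      rw [hk]; push_cast; ring
  obtain ⟨k, hk⟩ := hfin
  rw [hc] at hk
  have hk' : 1 - r ^ 2 = (2 * k : ℝ) ^ 2 := by exact_mod_cast hk
  have hk0 : k = 0 := by
    by_contra hne
    have h1 : (1 : ℤ) ≤ k ^ 2 := by
      have : 0 < k ^ 2 := by positivity
      omega
    have h1' : (1 : ℝ) ≤ (k : ℝ) ^ 2 := by exact_mod_cast h1
    nlinarith [sq_nonneg r]
  rw [hk0] at hk'
  simp at hk'
  linarith

theorem part2_aux [Nontrivial A] [Nonempty K]
    (ha : ∀ i, a i * a i = 1)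
    (hb : ∀ i, b i * b i = 1)
    (haa : ∀ i j, i ≠ j → a i * a j = -(a j * a i))
    (hbb : ∀ i j, i ≠ j → b i * b j = -(b j * b i))
    (hab : ∀ i j, a i * b j = b j * a i)
    (t : Finset K) :
    ∃ v : A, v ≠ 0 ∧ a none * v = v ∧ ∀ k ∈ t,
      (a (some (k, true)) * b (some (k, true))) *
        ((a (some (k, false)) * b (some (k, false))) * v) = -v := by
  classical
  induction t using Finset.induction_on with
  | empty =>
    refine ⟨1 + a none, ?_, ?_, by simp⟩
    · intro h
      have h1 : a none = -1 := eq_neg_of_add_eq_zero_right h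
      obtain ⟨k⟩ := ‹Nonempty K›
      have h2 := haa none (some (k, true)) (by simp)
      rw [h1] at h2
      have h3 : (2 : ℂ) • a (some (k, true)) = 0 := by
        rw [two_smul]
        simp at h2
        nth_rewrite 1 [← neg_neg (a (some (k, true)))]
        rw [h2]
        simp
      have h4 := (smul_eq_zero.mp h3).resolve_left (by norm_num)
      have h5 := ha (some (k, true))
      rw [h4] at h5
      simp at h5
    · rw [mul_add, ha, mul_one, add_comm]
  | insert k t hk ih =>
    obtain ⟨v, hv, hav, hvt⟩ := ih
    set s : K × Bool → A := fun x => a (some x) * b (some x) with hs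
    have hsc : ∀ x y, s x * s y = s y * s x := fun x y => s_comm a b haa hbb hab _ _
    have hss : ∀ x, s x * s x = 1 := fun x => s_sq a b ha hb hab _
    have hsb : ∀ x y, x ≠ y → s x * b (some y) = -(b (some y) * s x) :=
      fun x y h => s_b a b hbb hab _ _ (by simpa using h)
    have hsb' : ∀ x, s x * b (some x) = b (some x) * s x :=
      fun x => s_b_same a b hab _
    have hsa : ∀ x, s x * a none = -(a none * s x) := fun x => s_a a b haa hab _ _ (by simp)
    set p : K → A := fun l => s (l, true) * s (l, false) with hp
    have hpp : ∀ l, p l * p l = 1 := by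
      intro l
      calc p l * p l = s (l, true) * (s (l, false) * s (l, true)) * s (l, false) := by
            simp only [hp, mul_assoc]
        _ = (s (l, true) * s (l, true)) * (s (l, false) * s (l, false)) := by
            rw [hsc (l, false) (l, true)]; simp only [mul_assoc]
        _ = 1 := by rw [hss, hss, one_mul]
    have hpc : ∀ l m, p l * p m = p m * p l := by
      intro l m
      have h1 : ∀ x, Commute (s x) (p m) := fun x => Commute.mul_right (hsc _ _) (hsc _ _)
      exact Commute.mul_left (h1 _) (h1 _)
    have hpa : ∀ l, p l * a none = a none * p l := by
      intro l
      simp only [hp]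
      rw [mul_assoc, hsa, mul_neg, ← mul_assoc, hsa, neg_mul, neg_neg, mul_assoc]
    have hpb : ∀ l, l ≠ k → p l * b (some (k, true)) = b (some (k, true)) * p l := by
      intro l hl
      simp only [hp]
      rw [mul_assoc, hsb _ _ (by simp [hl]), mul_neg, ← mul_assoc, hsb _ _ (by simp [hl]),
        neg_mul, neg_neg, mul_assoc]
    have hpb' : p k * b (some (k, true)) = -(b (some (k, true)) * p k) := by
      simp only [hp]
      rw [mul_assoc, hsb _ _ (by simp), mul_neg, ← mul_assoc, hsb', mul_assoc]
    have hvt' : ∀ l ∈ t, p l * v = -v := fun l hl => by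
      have := hvt l hl
      rw [← mul_assoc] at this
      exact this
    suffices H : ∃ w : A, w ≠ 0 ∧ a none * w = w ∧ ∀ l ∈ insert k t, p l * w = -w by
      obtain ⟨w, h1, h2, h3⟩ := H
      refine ⟨w, h1, h2, fun l hl => ?_⟩
      rw [← mul_assoc]
      exact h3 l hl
    by_cases hw : v - p k * v = 0
    · have hpv : p k * v = v := (sub_eq_zero.mp hw).symm
      refine ⟨b (some (k, true)) * v, ?_, ?_, ?_⟩
      · intro h0
        apply hv
        rw [← one_mul v, ← hb (some (k, true)), mul_assoc, h0, mul_zero]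
      · rw [← mul_assoc, hab, mul_assoc, hav]
      · intro l hl
        rcases Finset.mem_insert.mp hl with rfl | hl'
        · rw [← mul_assoc, hpb', neg_mul, mul_assoc, hpv]
        · rw [← mul_assoc, hpb l (by rintro rfl; exact hk hl'), mul_assoc, hvt' l hl', mul_neg]
    · refine ⟨v - p k * v, hw, ?_, ?_⟩
      · rw [mul_sub, hav, ← mul_assoc, ← hpa, mul_assoc, hav]
      · intro l hl
        rcases Finset.mem_insert.mp hl with rfl | hl'
        · rw [mul_sub, ← mul_assoc, hpp, one_mul, neg_sub]
        · rw [mul_sub, ← mul_assoc (p l) (p k) v, hpc l k, mul_assoc (p k) (p l) v, hvt' l hl',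
            mul_neg]
          abel

theorem part2 [Nontrivial A] [Nonempty K]
    (ha : ∀ i, a i * a i = 1)
    (hb : ∀ i, b i * b i = 1)
    (haa : ∀ i j, i ≠ j → a i * a j = -(a j * a i))
    (hbb : ∀ i j, i ≠ j → b i * b j = -(b j * b i))
    (hab : ∀ i j, a i * b j = b j * a i)
    :
    ∃ v : A, v ≠ 0 ∧ (∑ i, a i * b i - b none) * v = 0 := by
  obtain ⟨v, hv, hav, h⟩ := part2_aux a b ha hb haa hbb hab Finset.univ
  refine ⟨v, hv, ?_⟩
  rw [Fintype.sum_option, Fintype.sum_prod_type, sub_mul, add_mul, hab, mul_assoc, hav,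
    Finset.sum_mul, Finset.sum_eq_zero, add_zero, sub_self]
  intro k _
  rw [Fintype.sum_bool, add_mul]
  have h1 := h k (Finset.mem_univ _)
  have h2 := congrArg (fun x => (a (some (k, true)) * b (some (k, true))) * x) h1
  rw [← mul_assoc (a (some (k, true)) * b (some (k, true))) (a (some (k, true)) * b (some (k, true))),
    s_sq a b ha hb hab, one_mul, mul_neg] at h2
  rw [h2, add_neg_cancel]

end

section
variable {d : ℕ}

/-- the Clifford element attached to a vector -/
noncomputable def G (α : Fin d → A) (x : EuclideanSpace ℝ (Fin d)) : A := ∑ j, (x j : ℂ) • α j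

lemma G_mul (α β : Fin d → A) (x y : EuclideanSpace ℝ (Fin d)) :
    G α x * G β y = ∑ j, ∑ k, ((x j : ℂ) * y k) • (α j * β k) := by
  simp only [G, Finset.sum_mul_sum, smul_mul_smul_comm]

lemma G_anti (α : Fin d → A) (h1 : ∀ j, α j * α j = 1)
    (h2 : ∀ j k, j ≠ k → α j * α k = -(α k * α j)) (x y : EuclideanSpace ℝ (Fin d)) :
    G α x * G α y + G α y * G α x = ((2 * inner ℝ x y : ℝ) : ℂ) • (1 : A) := by
  have e1 : G α x * G α y = ∑ j, ∑ k, ((x j : ℂ) * y k) • (α j * α k) := by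
    exact G_mul _ _ _ _
  have e2 : G α y * G α x = ∑ j, ∑ k, ((x j : ℂ) * y k) • (α k * α j) := by
    rw [G_mul, Finset.sum_comm]
    simp only [mul_comm (Complex.ofReal (y _))]
  have e3 : ∀ j k, α j * α k + α k * α j = if j = k then (2 : ℂ) • (1 : A) else 0 := by
    intro j k
    split_ifs with h
    · rw [h, h1, two_smul]
    · rw [h2 j k h, neg_add_cancel]
  rw [e1, e2, ← Finset.sum_add_distrib]
  simp only [← Finset.sum_add_distrib, ← smul_add, e3, smul_ite, smul_zero,
    Finset.sum_ite_eq, Finset.mem_univ, if_true, smul_smul]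
  rw [← Finset.sum_smul]
  congr 1
  rw [PiLp.inner_apply, Finset.mul_sum]
  push_cast
  refine Finset.sum_congr rfl fun j _ => ?_
  simp
  ring

lemma G_comm (α β : Fin d → A) (h : ∀ i j, α i * β j = β j * α i)
    (x y : EuclideanSpace ℝ (Fin d)) : G α x * G β y = G β y * G α x := by
  rw [G_mul, G_mul, Finset.sum_comm]
  simp only [h, mul_comm (Complex.ofReal (y _))]

lemma G_sum {ι : Type*} [Fintype ι] (b : OrthonormalBasis ι ℝ (EuclideanSpace ℝ (Fin d)))
    (α β : Fin d → A) : ∑ i, G α (b i) * G β (b i) = ∑ j, α j * β j := by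
  have e : ∀ j k, ∑ i, ((b i j : ℂ) * b i k) = if j = k then 1 else 0 := by
    intro j k
    have := b.sum_inner_mul_inner (EuclideanSpace.single j (1 : ℝ)) (EuclideanSpace.single k 1)
    simp only [EuclideanSpace.inner_single_left, EuclideanSpace.inner_single_right] at this
    have h2 : ∑ i, (b i j * b i k) = if j = k then (1 : ℝ) else 0 := by
      simpa [Pi.single_apply, eq_comm] using this
    have h3 := congrArg (fun x : ℝ => (x : ℂ)) h2
    split_ifs at h3 ⊢ <;> simpa using h3
  have e1 : ∀ i, G α (b i) * G β (b i) = ∑ j, ∑ k, ((b i j : ℂ) * b i k) • (α j * β k) := by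
    intro i
    exact G_mul _ _ _ _
  simp only [e1]
  rw [Finset.sum_comm]
  refine Finset.sum_congr rfl fun j _ => ?_
  rw [Finset.sum_comm]
  simp only [← Finset.sum_smul, e]
  simp

theorem main_abs [Nontrivial A] (m : ℕ) (hm : 0 < m) (hd : d = 2 * m + 1) (α β : Fin d → A)
    (ha : ∀ i, α i * α i = 1) (hb : ∀ i, β i * β i = 1)
    (haa : ∀ i j, i ≠ j → α i * α j = -(α j * α i))
    (hbb : ∀ i j, i ≠ j → β i * β j = -(β j * β i))
    (hab : ∀ i j, α i * β j = β j * α i) (x : EuclideanSpace ℝ (Fin d)) :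
    (∃ v : A, v ≠ 0 ∧ (∑ j, α j * β j - G β x) * v = 0) ↔ ‖x‖ = 1 := by
  classical
  have hK : Nonempty (Fin m) := ⟨⟨0, hm⟩⟩
  obtain ⟨u, hu, hxu⟩ : ∃ u : EuclideanSpace ℝ (Fin d), ‖u‖ = 1 ∧ x = ‖x‖ • u := by
    by_cases hx : x = 0
    · refine ⟨EuclideanSpace.single ⟨0, by omega⟩ 1, by simp, by simp [hx]⟩
    · have : ‖x‖ ≠ 0 := norm_ne_zero_iff.mpr hx
      refine ⟨‖x‖⁻¹ • x, ?_, ?_⟩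
      · rw [norm_smul, norm_inv, norm_norm, inv_mul_cancel₀ this]
      · rw [smul_smul, mul_inv_cancel₀ this, one_smul]
  have hcard : Module.finrank ℝ (EuclideanSpace ℝ (Fin d))
      = Fintype.card (Option (Fin m × Bool)) := by
    simp [hd, mul_comm]
  obtain ⟨b, hbu⟩ := Orthonormal.exists_orthonormalBasis_extension_of_card_eq (𝕜 := ℝ)
    (E := EuclideanSpace ℝ (Fin d)) hcard (v := fun _ => u)
    (s := {none}) (by
      rw [orthonormal_iff_ite]
      rintro ⟨i, hi⟩ ⟨j, hj⟩
      simp only [Set.mem_singleton_iff] at hi hj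
      subst hi hj
      simp [hu])
  have hbn : b none = u := hbu none rfl
  have sq : ∀ (δ : Fin d → A), (∀ i, δ i * δ i = 1) → (∀ i j, i ≠ j → δ i * δ j = -(δ j * δ i)) →
      ∀ i, G δ (b i) * G δ (b i) = 1 := by
    intro δ h1 h2 i
    have h := G_anti δ h1 h2 (b i) (b i)
    rw [real_inner_self_eq_norm_sq, b.norm_eq_one, ← two_smul ℂ] at h
    norm_num at h
    have h' := congrArg (fun y => (2 : ℂ)⁻¹ • y) h
    simpa [smul_smul] using h'
  have anti : ∀ (δ : Fin d → A), (∀ i, δ i * δ i = 1) →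
      (∀ i j, i ≠ j → δ i * δ j = -(δ j * δ i)) →
      ∀ i j, i ≠ j → G δ (b i) * G δ (b j) = -(G δ (b j) * G δ (b i)) := by
    intro δ h1 h2 i j hij
    have h := G_anti δ h1 h2 (b i) (b j)
    rw [b.inner_eq_zero hij] at h
    apply eq_neg_of_add_eq_zero_left
    rw [h]; simp
  have hG : G β x = ((‖x‖ : ℝ) : ℂ) • G β (b none) := by
    rw [hbn]
    nth_rewrite 1 [hxu]
    simp only [G, Finset.smul_sum, smul_smul, PiLp.smul_apply, smul_eq_mul, Complex.ofReal_mul]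
  rw [hG, ← G_sum b]
  constructor
  · rintro ⟨v, hv, h⟩
    have := part1 (fun i => G α (b i)) (fun i => G β (b i)) (sq α ha haa) (sq β hb hbb)
      (anti α ha haa) (anti β hb hbb) (fun i j => G_comm α β hab _ _) ‖x‖ v hv h
    nlinarith [norm_nonneg x]
  · intro hx
    obtain ⟨v, hv, h⟩ := part2 (fun i => G α (b i)) (fun i => G β (b i)) (sq α ha haa) (sq β hb hbb)
      (anti α ha haa) (anti β hb hbb) (fun i j => G_comm α β hab _ _)
    refine ⟨v, hv, ?_⟩
    rw [hx]
    simpa using h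

end

lemma not_isUnit_iff {n : Type*} [Fintype n] [DecidableEq n] (M : Matrix n n ℂ) :
    ¬ IsUnit M ↔ ∃ v : Matrix n n ℂ, v ≠ 0 ∧ M * v = 0 := by
  constructor
  · intro h
    rw [Matrix.isUnit_iff_isUnit_det, isUnit_iff_ne_zero, not_not] at h
    obtain ⟨x, hx, hMx⟩ := Matrix.exists_mulVec_eq_zero_iff.mpr h
    refine ⟨Matrix.vecMulVec x x, ?_, ?_⟩
    · simpa [Matrix.vecMulVec_eq_zero] using hx
    · rw [Matrix.mul_vecMulVec, hMx, Matrix.zero_vecMulVec]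
  · rintro ⟨v, hv, h⟩ hu
    exact hv (hu.mul_right_eq_zero.mp h)

end CliffAux

open CliffAux

theorem clifford_spectrum_odd_clifford_rep
    {d : ℕ} (hd : Odd d) (hd3 : 3 ≤ d)
    (γ : Fin d → Matrix (Fin (2 ^ ((d - 1) / 2))) (Fin (2 ^ ((d - 1) / 2))) ℂ)
    (hherm : ∀ j, (γ j).IsHermitian)
    (hsq : ∀ j, γ j * γ j = 1)
    (hanti : ∀ j k, j ≠ k → γ j * γ k = -(γ k * γ j))
    (hsign : γ ⟨d - 1, by omega⟩ =
      (Complex.I ^ ((d + 3) / 2)) •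
        ((List.ofFn fun j : Fin (d - 1) => γ (Fin.castLE (by omega) j)).reverse.prod)) :
    {lam : EuclideanSpace ℝ (Fin d) |
      ¬ IsUnit (∑ j, ((γ j - (lam j : ℂ) • 1) ⊗ₖ γ j))} = Metric.sphere 0 1 := by
  classical
  clear hsign hherm
  obtain ⟨m, hm⟩ := hd
  have hN : Nonempty (Fin (2 ^ ((d - 1) / 2))) := ⟨⟨0, by positivity⟩⟩
  ext lam
  rw [Set.mem_ofPred_eq, mem_sphere_zero_iff_norm, not_isUnit_iff,
    ← main_abs m (by omega) hm (fun j => γ j ⊗ₖ (1 : Matrix (Fin (2 ^ ((d - 1) / 2))) _ ℂ))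
      (fun j => (1 : Matrix (Fin (2 ^ ((d - 1) / 2))) _ ℂ) ⊗ₖ γ j)]
  · have : (∑ j, ((γ j - (lam j : ℂ) • 1) ⊗ₖ γ j)) =
        ∑ j, (γ j ⊗ₖ (1 : Matrix (Fin (2 ^ ((d - 1) / 2))) _ ℂ)) *
          ((1 : Matrix (Fin (2 ^ ((d - 1) / 2))) _ ℂ) ⊗ₖ γ j) -
        G (fun j => (1 : Matrix (Fin (2 ^ ((d - 1) / 2))) _ ℂ) ⊗ₖ γ j) lam := by
      rw [G, ← Finset.sum_sub_distrib]
      refine Finset.sum_congr rfl fun j _ => ?_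
      rw [← Matrix.mul_kronecker_mul, mul_one, one_mul, ← Matrix.smul_kronecker]
      ext ⟨i, i'⟩ ⟨k, k'⟩
      simp [Matrix.kroneckerMap_apply, sub_mul]
    rw [this]
  · intro j
    rw [← Matrix.mul_kronecker_mul, hsq, one_mul, Matrix.one_kronecker_one]
  · intro j
    rw [← Matrix.mul_kronecker_mul, hsq, one_mul, Matrix.one_kronecker_one]
  · intro j k h
    rw [← Matrix.mul_kronecker_mul, ← Matrix.mul_kronecker_mul, hanti j k h]
    ext ⟨i, i'⟩ ⟨k, k'⟩
    simp [Matrix.kroneckerMap_apply]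
  · intro j k h
    rw [← Matrix.mul_kronecker_mul, ← Matrix.mul_kronecker_mul, hanti j k h]
    ext ⟨i, i'⟩ ⟨k, k'⟩
    simp [Matrix.kroneckerMap_apply]
  · intro j k
    rw [← Matrix.mul_kronecker_mul, ← Matrix.mul_kronecker_mul]
    simp only [mul_one, one_mul]
end

section
/- If d ≥ 3 is odd and γ₁,…,γ_d is an irreducible representation of the Clifford relations, then sig(L_λ(γ₁,…,γ_d)) = C(d-1, (d-1)/2) (the central binomial coefficient) for |λ| < 1, and sig(L_λ) = 0 for |λ| > 1. -/
open scoped Kronecker Matrix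

/-- Signature of a Hermitian matrix: number of positive minus number of
negative eigenvalues (junk value `0` for non-Hermitian matrices). -/
noncomputable def sig {ι : Type*} [Fintype ι] [DecidableEq ι]
    (M : Matrix ι ι ℂ) : ℤ :=
  if h : M.IsHermitian then
    ((Finset.univ.filter fun i => 0 < h.eigenvalues i).card : ℤ) -
    ((Finset.univ.filter fun i => h.eigenvalues i < 0).card : ℤ)
  else 0


section CliffordSig
open Matrix Finset
open scoped ComplexOrder

theorem sigAux_vec {ι : Type*} [Fintype ι] [DecidableEq ι] (M S : Matrix ι ι ℂ)
    (hSS : S * S = 1) (hc : S * M = M * S) (hpos : (S * M).PosDef)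
    (v : ι → ℂ) (μ : ℝ) (hv : M *ᵥ v = (μ : ℂ) • v) (hv0 : v ≠ 0) :
    S *ᵥ v = ((if 0 < μ then 1 else if μ < 0 then -1 else 0 : ℂ)) • v ∧ μ ≠ 0 := by
  have hMS : M *ᵥ (S *ᵥ v) = (μ : ℂ) • (S *ᵥ v) := by
    rw [mulVec_mulVec, ← hc, ← mulVec_mulVec, hv, mulVec_smul]
  have hSSv : S *ᵥ (S *ᵥ v) = v := by rw [mulVec_mulVec, hSS, one_mulVec]
  have key : ∀ w : ι → ℂ, ∀ r : ℝ, r ≤ 0 → (S * M) *ᵥ w = (r : ℂ) • w → w = 0 := by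
    intro w r hr h
    by_contra hw
    have h1 := hpos.dotProduct_mulVec_pos hw
    rw [h, dotProduct_smul, smul_eq_mul] at h1
    have h2 : 0 ≤ star w ⬝ᵥ w := dotProduct_star_self_nonneg w
    have h3 : (r : ℂ) * (star w ⬝ᵥ w) ≤ 0 :=
      mul_nonpos_of_nonpos_of_nonneg (by exact_mod_cast hr) h2
    exact absurd h1 (not_lt_of_ge h3)
  rcases lt_trichotomy μ 0 with h | h | h
  · refine ⟨?_, h.ne⟩
    have := key (v + S *ᵥ v) μ h.le (by
      rw [← mulVec_mulVec, mulVec_add, hMS, hv, mulVec_add, mulVec_smul, mulVec_smul, hSSv, smul_add, add_comm])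
    simp only [not_lt_of_gt h, h, if_true, if_false, neg_smul, one_smul]
    exact eq_neg_of_add_eq_zero_right this
  · exfalso
    apply hv0
    apply key v 0 le_rfl
    rw [← mulVec_mulVec, hv, h]; simp
  · refine ⟨?_, h.ne'⟩
    have := key (v - S *ᵥ v) (-μ) (by linarith) (by
      rw [← mulVec_mulVec, mulVec_sub, hMS, hv, mulVec_sub, mulVec_smul, mulVec_smul, hSSv]
      push_cast
      rw [neg_smul, ← smul_neg, neg_sub, smul_sub])
    simp only [h, if_true, one_smul]
    exact (sub_eq_zero.mp this).symm

theorem sig_eq_trace {ι : Type*} [Fintype ι] [DecidableEq ι] (M S : Matrix ι ι ℂ)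
    (hM : M.IsHermitian)
    (hSS : S * S = 1) (hc : S * M = M * S) (hpos : (S * M).PosDef) :
    ((sig M : ℤ) : ℂ) = S.trace := by
  set U : Matrix ι ι ℂ := (hM.eigenvectorUnitary : Matrix ι ι ℂ) with hU
  have hUU : star U * U = 1 := Unitary.coe_star_mul_self hM.eigenvectorUnitary
  have hUU' : U * star U = 1 := Unitary.coe_mul_star_self hM.eigenvectorUnitary
  set f : ι → ℂ := fun i => if 0 < hM.eigenvalues i then 1 else
    if hM.eigenvalues i < 0 then -1 else 0 with hf
  have hSU : S * U = U * diagonal f := by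
    ext a i
    have h1 := (sigAux_vec M S hSS hc hpos (⇑(hM.eigenvectorBasis i)) (hM.eigenvalues i)
      (by simpa using hM.mulVec_eigenvectorBasis i)
      (by
        intro h
        have h2 := hM.eigenvectorBasis.orthonormal.ne_zero i
        apply h2
        ext x
        exact congrFun h x)).1
    have h2 := congrFun h1 a
    rw [mul_diagonal]
    simp only [mul_apply, hU, Matrix.IsHermitian.eigenvectorUnitary_apply]
    simp only [mulVec, dotProduct, Pi.smul_apply, smul_eq_mul] at h2
    rw [h2, mul_comm]
  have : S.trace = ∑ i, f i := by
    calc S.trace = (S * (U * star U)).trace := by rw [hUU', mul_one]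
      _ = (U * diagonal f * star U).trace := by rw [← mul_assoc, hSU]
      _ = (diagonal f).trace := by rw [trace_mul_comm, ← mul_assoc, hUU, one_mul]
      _ = _ := by simp [trace]
  rw [this, sig, dif_pos hM, Finset.card_filter, Finset.card_filter]
  push_cast
  rw [← Finset.sum_sub_distrib]
  apply Finset.sum_congr rfl
  intro i _
  simp only [hf]
  rcases lt_trichotomy (hM.eigenvalues i) 0 with h | h | h
  · simp [h, not_lt_of_gt h]
  · simp [h]
  · simp [h, not_lt_of_gt h]

/-- sign attached to a boolean -/
noncomputable def sgb (b : Bool) : ℂ := if b then -1 else 1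

theorem sgb_sq (b : Bool) : sgb b * sgb b = 1 := by cases b <;> simp [sgb]
theorem sgb_star (b : Bool) : star (sgb b) = sgb b := by cases b <;> simp [sgb]
theorem sgb_not (b : Bool) : sgb (!b) = - sgb b := by cases b <;> simp [sgb]
theorem sgb_xor (b c : Bool) : sgb (xor b c) = sgb b * sgb c := by
  cases b <;> cases c <;> simp [sgb]
theorem sgb_ne (b c : Bool) (h : b ≠ c) : sgb b ≠ sgb c := by
  revert h; cases b <;> cases c <;> norm_num [sgb]

/-- the joint spectral projection of a commuting family of involutions -/
noncomputable def Qp {ι : Type*} [Fintype ι] [DecidableEq ι] {n : ℕ} (A : Fin n → Matrix ι ι ℂ)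
    (ε : Fin n → Bool) : Matrix ι ι ℂ :=
  (List.ofFn fun j => (1 / 2 : ℂ) • (1 + sgb (ε j) • A j)).prod

section Q
variable {ι : Type*} [Fintype ι] [DecidableEq ι] {n : ℕ}

theorem Qp_succ (A : Fin (n + 1) → Matrix ι ι ℂ) (ε : Fin (n + 1) → Bool) :
    Qp A ε = ((1 / 2 : ℂ) • (1 + sgb (ε 0) • A 0)) * Qp (fun j => A j.succ) (fun j => ε j.succ) := by
  simp [Qp, List.ofFn_succ]

theorem Qp_sum (A : Fin n → Matrix ι ι ℂ) : ∑ ε, Qp A ε = 1 := by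
  induction n with
  | zero => simp [Qp]
  | succ n ih =>
    rw [← (Fin.consEquiv (fun _ : Fin (n + 1) => Bool)).sum_comp, Fintype.sum_prod_type]
    simp only [Qp_succ, Fin.consEquiv, Equiv.coe_fn_mk, Fin.cons_zero, Fin.cons_succ]
    simp only [← Finset.mul_sum, ih, mul_one]
    simp only [Fintype.univ_bool, Finset.mem_singleton, reduceCtorEq, not_false_eq_true,
      Finset.sum_insert, Finset.sum_singleton, sgb]
    simp only [if_true, if_false, ← smul_add]
    module

theorem Qp_twist (A : Fin n → Matrix ι ι ℂ) (X : Matrix ι ι ℂ) (b : Fin n → Bool)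
    (hX : ∀ j, X * A j = sgb (b j) • (A j * X)) (ε : Fin n → Bool) :
    X * Qp A ε = Qp A (fun j => xor (ε j) (b j)) * X := by
  induction n with
  | zero => simp [Qp]
  | succ n ih =>
    rw [Qp_succ, Qp_succ, mul_assoc, ← ih _ _ (fun j => hX j.succ), ← mul_assoc, ← mul_assoc]
    congr 1
    rw [mul_smul_comm, mul_add, mul_smul_comm, hX, sgb_xor, smul_mul_assoc, add_mul, smul_mul_assoc,
      smul_smul, mul_one, one_mul]

theorem Qp_comm (A : Fin n → Matrix ι ι ℂ) (X : Matrix ι ι ℂ)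
    (hX : ∀ j, X * A j = A j * X) (ε : Fin n → Bool) :
    X * Qp A ε = Qp A ε * X := by
  have := Qp_twist A X (fun _ => false) (by simpa [sgb] using hX) ε
  simpa using this

theorem Qp_eig (A : Fin n → Matrix ι ι ℂ) (hsq : ∀ j, A j * A j = 1)
    (hc : ∀ j k, A j * A k = A k * A j) (ε : Fin n → Bool) (k : Fin n) :
    A k * Qp A ε = sgb (ε k) • Qp A ε := by
  induction n with
  | zero => exact k.elim0
  | succ n ih =>
    rw [Qp_succ]
    refine Fin.cases ?_ (fun k => ?_) k
    · rw [← mul_assoc, ← smul_mul_assoc]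
      congr 1
      rw [mul_smul_comm, mul_add, mul_smul_comm, hsq, mul_one, smul_comm (sgb (ε 0)), smul_add (sgb (ε 0)), smul_smul (sgb (ε 0)), sgb_sq,
        one_smul, add_comm]
    · have h1 : A k.succ * ((1 / 2 : ℂ) • (1 + sgb (ε 0) • A 0)) =
        ((1 / 2 : ℂ) • (1 + sgb (ε 0) • A 0)) * A k.succ := by
        rw [mul_smul_comm, mul_add, mul_smul_comm, hc, smul_mul_assoc, add_mul, smul_mul_assoc,
          mul_one, one_mul]
      rw [← mul_assoc, h1, mul_assoc, ih (fun j => A j.succ) (fun j => hsq _) (fun j k => hc _ _) _ k,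
        mul_smul_comm]

theorem Qp_herm (A : Fin n → Matrix ι ι ℂ) (hh : ∀ j, (A j).IsHermitian)
    (hc : ∀ j k, A j * A k = A k * A j) (ε : Fin n → Bool) :
    (Qp A ε)ᴴ = Qp A ε := by
  induction n with
  | zero => simp [Qp]
  | succ n ih =>
    rw [Qp_succ, conjTranspose_mul, ih (fun j => A j.succ) (fun j => hh _) (fun j k => hc _ _)]
    have h2 : ((1 / 2 : ℂ) • (1 + sgb (ε 0) • A 0))ᴴ = (1 / 2 : ℂ) • (1 + sgb (ε 0) • A 0) := by
      rw [conjTranspose_smul, conjTranspose_add, conjTranspose_smul, (hh 0).eq, sgb_star,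
        conjTranspose_one]
      simp
    rw [h2]
    symm
    apply Qp_comm
    intro j
    rw [mul_smul_comm, mul_add, mul_smul_comm, hc, smul_mul_assoc, add_mul, smul_mul_assoc,
          mul_one, one_mul]

theorem Qp_orth (A : Fin n → Matrix ι ι ℂ) (hsq : ∀ j, A j * A j = 1)
    (hc : ∀ j k, A j * A k = A k * A j) (ε δ : Fin n → Bool) (h : ε ≠ δ) :
    Qp A ε * Qp A δ = 0 := by
  obtain ⟨k, hk⟩ := Function.ne_iff.mp h
  have h1 : Qp A ε * (A k * Qp A δ) = sgb (δ k) • (Qp A ε * Qp A δ) := by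
    rw [Qp_eig A hsq hc, mul_smul_comm]
  have h2 : Qp A ε * (A k * Qp A δ) = sgb (ε k) • (Qp A ε * Qp A δ) := by
    rw [← mul_assoc, ← Qp_comm A (A k) (fun j => hc _ _), Qp_eig A hsq hc, smul_mul_assoc]
  rw [h1] at h2
  have h3 : (sgb (δ k) - sgb (ε k)) • (Qp A ε * Qp A δ) = 0 := by rw [sub_smul, h2, sub_self]
  rcases smul_eq_zero.mp h3 with h4 | h4
  · exact absurd (sub_eq_zero.mp h4).symm (sgb_ne _ _ hk)
  · exact h4

theorem Qp_idem (A : Fin n → Matrix ι ι ℂ) (hsq : ∀ j, A j * A j = 1)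
    (hc : ∀ j k, A j * A k = A k * A j) (ε : Fin n → Bool) :
    Qp A ε * Qp A ε = Qp A ε := by
  have h := congrArg (fun M => Qp A ε * M) (Qp_sum A)
  simp only [Finset.mul_sum, mul_one] at h
  rw [Finset.sum_eq_single ε (fun δ _ hδ => Qp_orth A hsq hc ε δ hδ.symm) (by simp)] at h
  exact h

theorem Qp_trace (A : Fin n → Matrix ι ι ℂ) (hcard : Fintype.card ι = 2 ^ n)
    (hX : ∀ k, ∃ X Y : Matrix ι ι ℂ, Y * X = 1 ∧
      ∀ j, X * A j = sgb (decide (j = k)) • (A j * X)) (ε : Fin n → Bool) :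
    (Qp A ε).trace = 1 := by
  have hflip : ∀ k ε, (Qp A (fun j => xor (ε j) (decide (j = k)))).trace = (Qp A ε).trace := by
    intro k ε
    obtain ⟨X, Y, hYX, hX⟩ := hX k
    have h := Qp_twist A X _ hX ε
    have hXY : X * Y = 1 := mul_eq_one_comm.mp hYX
    calc _ = (Qp A (fun j => xor (ε j) (decide (j = k))) * (X * Y)).trace := by rw [hXY, mul_one]
      _ = (X * Qp A ε * Y).trace := by rw [← mul_assoc, ← h]
      _ = _ := by rw [trace_mul_comm, ← mul_assoc, hYX, one_mul]
  have hall : ∀ s : Finset (Fin n), ∀ ε,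
      (Qp A (fun j => xor (ε j) (decide (j ∈ s)))).trace = (Qp A ε).trace := by
    intro s
    induction s using Finset.induction_on with
    | empty => intro ε; simp
    | insert k s hk ih =>
      intro ε
      rw [← ih ε, ← hflip k]
      congr 2
      ext j
      by_cases hj : j = k
      · subst hj; simp [hk]
      · simp [hj]
  have hconst : ∀ δ, (Qp A δ).trace = (Qp A ε).trace := by
    intro δ
    rw [← hall (Finset.univ.filter fun j => xor (ε j) (δ j) = true) ε]
    congr 2
    ext j
    cases h1 : ε j <;> cases h2 : δ j <;> simp [h1, h2]
  have h := congrArg trace (Qp_sum A)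
  rw [trace_sum, Finset.sum_congr rfl (fun δ _ => hconst δ), trace_one, hcard] at h
  simp only [Finset.sum_const, Finset.card_univ, Fintype.card_fun, Fintype.card_bool,
    Fintype.card_fin, nsmul_eq_mul] at h
  have h2 : ((2 ^ n : ℕ) : ℂ) ≠ 0 := by positivity
  exact mul_left_cancel₀ h2 (by rw [h, mul_one])

end Q

/-- real-valued sign -/
noncomputable def sgr (b : Bool) : ℝ := if b then -1 else 1

theorem sgr_coe (b : Bool) : ((sgr b : ℝ) : ℂ) = sgb b := by cases b <;> simp [sgr, sgb]

/-- functional calculus of the commuting family -/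
noncomputable def Fop {ι : Type*} [Fintype ι] [DecidableEq ι] {n : ℕ} (A : Fin n → Matrix ι ι ℂ)
    (φ : (Fin n → Bool) → ℝ) : Matrix ι ι ℂ := ∑ ε, (φ ε : ℂ) • Qp A ε

section F
variable {ι : Type*} [Fintype ι] [DecidableEq ι] {n : ℕ}

theorem Fop_mul (A : Fin n → Matrix ι ι ℂ) (hsq : ∀ j, A j * A j = 1)
    (hc : ∀ j k, A j * A k = A k * A j) (φ ψ : (Fin n → Bool) → ℝ) :
    Fop A φ * Fop A ψ = Fop A (fun ε => φ ε * ψ ε) := by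
  simp only [Fop, Finset.sum_mul, Finset.mul_sum]
  refine Finset.sum_congr rfl fun ε _ => ?_
  rw [Finset.sum_eq_single ε]
  · rw [smul_mul_smul_comm, Qp_idem A hsq hc]; push_cast; rfl
  · intro δ _ h
    rw [smul_mul_smul_comm, Qp_orth A hsq hc _ _ h, smul_zero]
  · simp

theorem Fop_add (A : Fin n → Matrix ι ι ℂ) (φ ψ : (Fin n → Bool) → ℝ) :
    Fop A φ + Fop A ψ = Fop A (fun ε => φ ε + ψ ε) := by
  simp only [Fop, ← Finset.sum_add_distrib, ← add_smul]
  push_cast; rfl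

theorem Fop_smul (A : Fin n → Matrix ι ι ℂ) (r : ℝ) (φ : (Fin n → Bool) → ℝ) :
    (r : ℂ) • Fop A φ = Fop A (fun ε => r * φ ε) := by
  simp only [Fop, Finset.smul_sum, smul_smul]
  push_cast; rfl

theorem Fop_one (A : Fin n → Matrix ι ι ℂ) : Fop A (fun _ => 1) = 1 := by
  simp [Fop, Qp_sum]

theorem Fop_zero (A : Fin n → Matrix ι ι ℂ) : Fop A (fun _ => 0) = 0 := by
  simp [Fop]

theorem Fop_comm (A : Fin n → Matrix ι ι ℂ) (X : Matrix ι ι ℂ)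
    (hX : ∀ j, X * A j = A j * X) (φ : (Fin n → Bool) → ℝ) :
    X * Fop A φ = Fop A φ * X := by
  simp only [Fop, Finset.sum_mul, Finset.mul_sum, mul_smul_comm, smul_mul_assoc, Qp_comm A X hX]

theorem Fop_anti (A : Fin n → Matrix ι ι ℂ) (X : Matrix ι ι ℂ)
    (hX : ∀ j, X * A j = -(A j * X)) (φ : (Fin n → Bool) → ℝ) (hφ : ∀ ε, φ (fun j => !(ε j)) = φ ε) :
    X * Fop A φ = Fop A φ * X := by
  simp only [Fop, Finset.sum_mul, Finset.mul_sum, mul_smul_comm, smul_mul_assoc]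
  have hinv : Function.Involutive (fun (ε : Fin n → Bool) => fun j => !(ε j)) := by
    intro ε; ext j; simp
  rw [← Equiv.sum_comp hinv.toPerm]
  refine Finset.sum_congr rfl fun ε _ => ?_
  have h := Qp_twist A X (fun _ => true) (by simpa [sgb] using hX) (fun j => !(ε j))
  simp only [Function.Involutive.coe_toPerm, hφ]
  rw [h]
  simp

theorem Fop_gen (A : Fin n → Matrix ι ι ℂ) (hsq : ∀ j, A j * A j = 1)
    (hc : ∀ j k, A j * A k = A k * A j) : ∑ j, A j = Fop A (fun ε => ∑ j, sgr (ε j)) := by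
  have h : ∀ k, A k = ∑ ε, sgb (ε k) • Qp A ε := by
    intro k
    conv_lhs => rw [← mul_one (A k), ← Qp_sum A, Finset.mul_sum]
    simp only [Qp_eig A hsq hc]
  conv_lhs => enter [2, j]; rw [h j]
  rw [Finset.sum_comm]
  simp only [Fop]
  refine Finset.sum_congr rfl fun ε _ => ?_
  rw [← Finset.sum_smul]
  push_cast
  simp only [sgr_coe]

theorem Fop_herm (A : Fin n → Matrix ι ι ℂ) (hh : ∀ j, (A j).IsHermitian)
    (hc : ∀ j k, A j * A k = A k * A j) (φ : (Fin n → Bool) → ℝ) : (Fop A φ)ᴴ = Fop A φ := by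
  simp only [Fop, conjTranspose_sum, conjTranspose_smul, Qp_herm A hh hc]
  simp

theorem Fop_psd (A : Fin n → Matrix ι ι ℂ) (hh : ∀ j, (A j).IsHermitian) (hsq : ∀ j, A j * A j = 1)
    (hc : ∀ j k, A j * A k = A k * A j) (φ : (Fin n → Bool) → ℝ) (hφ : ∀ ε, 0 ≤ φ ε) :
    (Fop A φ).PosSemidef := by
  have h := posSemidef_conjTranspose_mul_self (Fop A (fun ε => √(φ ε)))
  rw [Fop_herm A hh hc, Fop_mul A hsq hc] at h
  simpa [Real.mul_self_sqrt, hφ] using h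

theorem Fop_trace (A : Fin n → Matrix ι ι ℂ) (htr : ∀ ε, (Qp A ε).trace = 1)
    (φ : (Fin n → Bool) → ℝ) : (Fop A φ).trace = ((∑ ε, φ ε : ℝ) : ℂ) := by
  simp [Fop, trace_sum, htr]

theorem psd_of_sq (P W : Matrix ι ι ℂ) (hP : Pᴴ = P) (hW : Wᴴ = W) (hPP : P * P = P)
    (hPW : P * W = W) (hWP : W * P = W) (hWW : W * W = P) : (P + W).PosSemidef := by
  have h := (posSemidef_conjTranspose_mul_self (P + W)).smul (a := (1 / 2 : ℝ)) (by norm_num)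
  have h2 : (1 / 2 : ℝ) • ((P + W)ᴴ * (P + W)) = P + W := by
    rw [conjTranspose_add, hP, hW, mul_add, add_mul, add_mul, hPP, hPW, hWP, hWW]
    module
  rwa [h2] at h

theorem main_abs (A : Fin n → Matrix ι ι ℂ) (hh : ∀ j, (A j).IsHermitian)
    (hsq : ∀ j, A j * A j = 1) (hc : ∀ j k, A j * A k = A k * A j) (hn : 0 < n)
    (D G : Matrix ι ι ℂ) (hD : Dᴴ = D) (hDD : D * D = 1) (hDA : ∀ j, D * A j = A j * D)
    (hG : Gᴴ = G) (hGG : G * G = 1) (hGA : ∀ j, G * A j = -(A j * G)) (hDG : D * G = G * D)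
    (htr : ∀ ε, (Qp A ε).trace = 1)
    (δ : (Fin n → Bool) → ℝ) (hδ : ∀ ε, D * Qp A ε = (δ ε : ℂ) • Qp A ε)
    (t c : ℝ) (hc0 : 0 < c) (χ : (Fin n → Bool) → ℝ) (hχ : ∀ ε, χ ε = 0 ∨ χ ε = 1)
    (hχe : ∀ ε, χ (fun j => !(ε j)) = χ ε)
    (h1 : ∀ ε, χ ε = 1 → ∑ j, sgr (ε j) = 0 ∧ |t| ≤ 1 - c)
    (h0 : ∀ ε, χ ε = 0 → 1 + c ≤ √((∑ j, sgr (ε j)) ^ 2 + t ^ 2)) :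
    ((sig (D + ∑ j, A j - (t : ℂ) • G) : ℤ) : ℂ) = ((∑ ε, χ ε * δ ε : ℝ) : ℂ) := by
  set s : (Fin n → Bool) → ℝ := fun ε => ∑ j, sgr (ε j) with hs
  have hse : ∀ ε, s (fun j => !(ε j)) = - s ε := by
    intro ε
    simp only [hs, ← Finset.sum_neg_distrib]
    refine Finset.sum_congr rfl fun j _ => ?_
    cases ε j <;> simp [sgr]
  set r : (Fin n → Bool) → ℝ := fun ε => √(s ε ^ 2 + t ^ 2) with hr
  have hr2 : ∀ ε, r ε * r ε = s ε ^ 2 + t ^ 2 := fun ε => Real.mul_self_sqrt (by positivity)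
  have hre : ∀ ε, r (fun j => !(ε j)) = r ε := by intro ε; simp only [hr, hse, neg_sq]
  have hr0 : ∀ ε, χ ε = 0 → r ε ≠ 0 := by
    intro ε h; have : 1 + c ≤ r ε := h0 ε h; linarith
  set h : (Fin n → Bool) → ℝ := fun ε => (1 - χ ε) / r ε with hhdef
  have hhe : ∀ ε, h (fun j => !(ε j)) = h ε := by intro ε; simp only [hhdef, hχe, hre]
  set P := Fop A χ with hPdef
  set H := Fop A h with hHdef
  set B := Fop A s with hBdef
  rw [Fop_gen A hsq hc]
  change ((sig (D + B - (t : ℂ) • G) : ℤ) : ℂ) = _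
  set N := B - (t : ℂ) • G with hNdef
  have mulF := Fop_mul A hsq hc
  have hAB : ∀ j, B * A j = A j * B := fun j => (Fop_comm A (A j) (fun k => hc _ _) s).symm
  have hGB : G * B = -(B * G) := by
    rw [hBdef, ← Fop_gen A hsq hc, Finset.mul_sum, Finset.sum_mul, ← Finset.sum_neg_distrib]
    exact Finset.sum_congr rfl fun j _ => hGA j
  have hDP : D * P = P * D := Fop_comm A D hDA χ
  have hDH : D * H = H * D := Fop_comm A D hDA h
  have hDB : D * B = B * D := Fop_comm A D hDA s
  have hGP : G * P = P * G := Fop_anti A G hGA χ hχe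
  have hGH : G * H = H * G := Fop_anti A G hGA h hhe
  have hBP : B * P = P * B := Fop_comm A B hAB χ
  have hBH : B * H = H * B := Fop_comm A B hAB h
  have hNP : N * P = P * N := by
    rw [hNdef, sub_mul, mul_sub, smul_mul_assoc, mul_smul_comm, hGP, hBP]
  have hNH : N * H = H * N := by
    rw [hNdef, sub_mul, mul_sub, smul_mul_assoc, mul_smul_comm, hGH, hBH]
  have hDN : D * N = N * D := by
    rw [hNdef, sub_mul, mul_sub, smul_mul_assoc, mul_smul_comm, hDG, hDB]
  have hPP : P * P = P := by
    rw [hPdef, mulF]; congr 1; ext ε; rcases hχ ε with e | e <;> simp [e]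
  have hPH : P * H = 0 := by
    rw [hPdef, hHdef, mulF, ← Fop_zero A]; congr 1; ext ε
    rcases hχ ε with e | e <;> simp [hhdef, e]
  have hHP : H * P = 0 := by
    rw [hPdef, hHdef, mulF, ← Fop_zero A]; congr 1; ext ε
    rcases hχ ε with e | e <;> simp [hhdef, e]
  have hPB : P * B = 0 := by
    rw [hPdef, hBdef, mulF, ← Fop_zero A]; congr 1; ext ε
    rcases hχ ε with e | e
    · simp [e]
    · have : s ε = 0 := (h1 ε e).1
      simp [this]
  have hNN : N * N = Fop A (fun ε => r ε * r ε) := by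
    have e1 : N * N = B * B + ((t ^ 2 : ℝ) : ℂ) • (1 : Matrix ι ι ℂ) := by
      rw [hNdef, sub_mul, mul_sub, mul_sub, smul_mul_smul_comm, hGG, smul_mul_assoc, mul_smul_comm,
        hGB]
      push_cast
      module
    rw [e1, hBdef, mulF, ← Fop_one A, Fop_smul, Fop_add]
    congr 1; ext ε; rw [hr2]; ring
  have h1P : 1 - P = Fop A (fun ε => 1 - χ ε) := by
    rw [sub_eq_iff_eq_add, hPdef, Fop_add]; simp [Fop_one]
  have hHHNN : H * H * (N * N) = 1 - P := by
    rw [hNN, h1P, hHdef, mulF, mulF]; congr 1; ext ε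
    rcases hχ ε with e | e
    · have := hr0 ε e
      simp only [hhdef, e]; field_simp; ring
    · simp [hhdef, e]
  have hHNN : H * (N * N) = Fop A (fun ε => (1 - χ ε) * r ε) := by
    rw [hNN, hHdef, mulF]; congr 1; ext ε
    rcases hχ ε with e | e
    · have := hr0 ε e
      simp only [hhdef, e]; field_simp
    · simp [hhdef, e]
  have hPN : P * N = -((t : ℂ) • (P * G)) := by
    rw [hNdef, mul_sub, hPB, mul_smul_comm, zero_sub]
  have hPh : Pᴴ = P := Fop_herm A hh hc χ
  have hHh : Hᴴ = H := Fop_herm A hh hc h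
  have hBh : Bᴴ = B := Fop_herm A hh hc s
  have hNh : Nᴴ = N := by
    rw [hNdef, conjTranspose_sub, hBh, conjTranspose_smul, hG]; simp
  have hL : D + B - (t : ℂ) • G = D + N := by rw [hNdef, add_sub_assoc]
  rw [hL]
  -- the sign matrix
  have hHNHN : (H * N) * (H * N) = 1 - P := by
    rw [← hHHNN, mul_assoc, ← mul_assoc N, hNH, mul_assoc H N N, ← mul_assoc]
  have hSS : (P * D + H * N) * (P * D + H * N) = 1 := by
    rw [mul_add, add_mul, add_mul, hHNHN]
    have e1 : P * D * (P * D) = P := by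
      rw [mul_assoc, ← mul_assoc D, hDP, mul_assoc P D D, hDD, mul_one, hPP]
    have e2 : H * N * (P * D) = 0 := by
      rw [mul_assoc, ← mul_assoc N, hNP, mul_assoc P, ← mul_assoc, hHP, zero_mul]
    have e3 : P * D * (H * N) = 0 := by
      rw [mul_assoc, ← mul_assoc D, hDH, mul_assoc H, ← mul_assoc, hPH, zero_mul]
    rw [e1, e2, e3]; abel
  have hcomm : (P * D + H * N) * (D + N) = (D + N) * (P * D + H * N) := by
    have c1 : Commute P D := hDP.symm
    have c2 : Commute P N := hNP.symm
    have c3 : Commute H D := hDH.symm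
    have c4 : Commute H N := hNH.symm
    have c5 : Commute D N := hDN
    exact ((((c1.add_right c2).mul_left ((Commute.refl D).add_right c5))).add_left
      ((c3.add_right c4).mul_left (c5.symm.add_right (Commute.refl N)))).eq
  have hUh : (P * D * G)ᴴ = P * D * G := by
    rw [conjTranspose_mul, conjTranspose_mul, hG, hD, hPh, hDP, ← mul_assoc, hGP, mul_assoc, ← hDG,
      mul_assoc]
  have hPU : P * (P * D * G) = P * D * G := by rw [← mul_assoc, ← mul_assoc, hPP]
  have hUP : (P * D * G) * P = P * D * G := by
    rw [mul_assoc, hGP, ← mul_assoc, mul_assoc P D P, hDP, ← mul_assoc, hPP]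
  have hUU : (P * D * G) * (P * D * G) = P := by
    calc (P * D * G) * (P * D * G) = (P * D * G) * P * (D * G) := by simp only [mul_assoc]
      _ = P * (D * ((G * D) * G)) := by rw [hUP]; simp only [mul_assoc]
      _ = P := by rw [← hDG, mul_assoc D G G, hGG, mul_one, hDD, mul_one]
  have hWh : (H * N * D)ᴴ = H * N * D := by
    rw [conjTranspose_mul, conjTranspose_mul, hNh, hD, hHh, hNH, ← mul_assoc, hDH, mul_assoc, hDN,
      mul_assoc]
  have hPW : P * (H * N * D) = 0 := by rw [← mul_assoc, ← mul_assoc, hPH, zero_mul, zero_mul]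
  have hWP : (H * N * D) * P = 0 := by
    rw [mul_assoc, hDP, ← mul_assoc, mul_assoc H N P, hNP, ← mul_assoc, hHP, zero_mul, zero_mul]
  have hWW : (H * N * D) * (H * N * D) = 1 - P := by
    have e : D * (H * N) = H * N * D := by rw [← mul_assoc, hDH, mul_assoc, hDN, mul_assoc]
    calc (H * N * D) * (H * N * D) = (H * N) * (D * (H * N)) * D := by simp only [mul_assoc]
      _ = (H * N) * (H * N) * (D * D) := by rw [e]; simp only [mul_assoc]
      _ = _ := by rw [hDD, mul_one, hHNHN]
  have psd1 : ((1 - P) + H * N * D).PosSemidef := by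
    apply psd_of_sq _ _ _ hWh _ _ _ hWW
    · rw [conjTranspose_sub, hPh, conjTranspose_one]
    · rw [sub_mul, one_mul, mul_sub, mul_one, hPP]; abel
    · rw [sub_mul, one_mul, hPW, sub_zero]
    · rw [mul_sub, mul_one, hWP, sub_zero]
  have psd2 : (Fop A (fun ε => (1 - χ ε) * (r ε - 1 - c))).PosSemidef := by
    apply Fop_psd A hh hsq hc
    intro ε
    rcases hχ ε with e | e
    · have : 1 + c ≤ r ε := h0 ε e
      rw [e]; linarith
    · simp [e]
  have psd3 : ((1 - c) • P - t • (P * D * G)).PosSemidef := by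
    by_cases hex : ∃ ε, χ ε = 1
    · obtain ⟨ε, e⟩ := hex
      have ht := abs_le.mp (h1 ε e).2
      have q1 := psd_of_sq P (P * D * G) hPh hUh hPP hPU hUP hUU
      have q2 := psd_of_sq P (-(P * D * G)) hPh (by rw [conjTranspose_neg, hUh]) hPP
        (by rw [mul_neg, hPU]) (by rw [neg_mul, hUP]) (by rw [neg_mul_neg, hUU])
      have q3 := (q1.smul (a := (1 - c - t) / 2) (by linarith)).add
        (q2.smul (a := (1 - c + t) / 2) (by linarith))
      convert q3 using 1
      module
    · have hP0 : P = 0 := by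
        rw [hPdef, ← Fop_zero A]; congr 1; ext ε
        rcases hχ ε with e | e
        · exact e
        · exact absurd ⟨ε, e⟩ hex
      rw [hP0]; simpa using PosSemidef.zero
  have hSL : (P * D + H * N) * (D + N) = c • (1 : Matrix ι ι ℂ) +
      (((1 - c) • P - t • (P * D * G)) + ((1 - P) + H * N * D) +
        Fop A (fun ε => (1 - χ ε) * (r ε - 1 - c))) := by
    have e1 : Fop A (fun ε => (1 - χ ε) * (r ε - 1 - c)) = H * (N * N) - (1 + c) • (1 - P) := by
      rw [eq_sub_iff_add_eq, hHNN, h1P, ← Complex.coe_smul, Fop_smul, Fop_add]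
      congr 1; ext ε; ring
    have e2 : P * D * N = - (t • (P * D * G)) := by
      rw [← hDP, mul_assoc, hPN, mul_neg, mul_smul_comm, ← Complex.coe_smul, mul_assoc D]
    have e3 : P * D * D = P := by rw [mul_assoc, hDD, mul_one]
    rw [e1, mul_add, add_mul, add_mul, e2, e3, mul_assoc H N N]
    module
  have hpos : ((P * D + H * N) * (D + N)).PosDef := by
    rw [hSL]
    exact (PosDef.one.smul hc0).add_posSemidef ((psd3.add psd1).add psd2)
  have hLh : (D + N).IsHermitian := by
    rw [IsHermitian, conjTranspose_add, hD, hNh]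
  rw [sig_eq_trace (D + N) (P * D + H * N) hLh hSS hcomm hpos, trace_add]
  have t1 : (P * D).trace = ((∑ ε, χ ε * δ ε : ℝ) : ℂ) := by
    rw [← hDP, hPdef, Fop, Finset.mul_sum, trace_sum]
    push_cast
    refine Finset.sum_congr rfl fun ε _ => ?_
    rw [mul_smul_comm, hδ, trace_smul, trace_smul, htr]; simp
  have t2 : (H * B).trace = 0 := by
    rw [hHdef, hBdef, mulF, Fop_trace A htr]
    have hinv : Function.Involutive (fun (ε : Fin n → Bool) => fun j => !(ε j)) := by
      intro ε; ext j; simp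
    have e : ∑ ε, h ε * s ε = - ∑ ε, h ε * s ε := by
      conv_lhs => rw [← Equiv.sum_comp hinv.toPerm]
      rw [← Finset.sum_neg_distrib]
      refine Finset.sum_congr rfl fun ε _ => ?_
      simp only [Function.Involutive.coe_toPerm, hhe, hse, mul_neg]
    have : ∑ ε, h ε * s ε = 0 := by linarith
    rw [this]; simp
  have t3 : (H * G).trace = 0 := by
    have hA0 : A ⟨0, hn⟩ * H = H * A ⟨0, hn⟩ := Fop_comm A _ (fun k => hc _ _) h
    set a := A ⟨0, hn⟩
    have e : (H * G).trace = - (H * G).trace := by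
      calc (H * G).trace = (H * G * (a * a)).trace := by rw [hsq, mul_one]
        _ = (a * (H * G * a)).trace := by rw [← mul_assoc, trace_mul_comm]
        _ = (a * (H * (G * a))).trace := by rw [mul_assoc]
        _ = (-(a * (a * (H * G)))).trace := by
          rw [hGA, mul_neg, mul_neg, ← mul_assoc H, ← hA0, mul_assoc a H]
        _ = _ := by rw [← mul_assoc, hsq, one_mul, trace_neg]
    exact self_eq_neg.mp e
  rw [t1, hNdef, mul_sub, trace_sub, t2, mul_smul_comm, trace_smul, t3]
  simp
end F

section Count

theorem sgr_sum {n : ℕ} (ε : Fin n → Bool) :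
    ∑ j, sgr (ε j) = (n : ℝ) - 2 * ((Finset.univ.filter fun j => ε j = true).card : ℝ) := by
  have h : ∀ j, sgr (ε j) = 1 - 2 * (if ε j = true then (1 : ℝ) else 0) := by
    intro j; cases ε j <;> norm_num [sgr]
  simp only [h, Finset.sum_sub_distrib, ← Finset.mul_sum, Finset.card_filter]
  simp

theorem sgr_prod {n : ℕ} (ε : Fin n → Bool) :
    ∏ j, sgr (ε j) = (-1) ^ (Finset.univ.filter fun j => ε j = true).card := by
  simp only [sgr, Finset.prod_ite, Finset.prod_const, one_pow, mul_one]

theorem count_sum (m : ℕ) :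
    ∑ ε : Fin (2 * m) → Bool, (if ∑ j, sgr (ε j) = 0 then (1 : ℝ) else 0) *
      ((-1) ^ m * ∏ j, sgr (ε j)) = ((2 * m).choose m : ℝ) := by
  have h1 : ∀ ε : Fin (2 * m) → Bool, (if ∑ j, sgr (ε j) = 0 then (1 : ℝ) else 0) *
      ((-1) ^ m * ∏ j, sgr (ε j)) =
      if (Finset.univ.filter fun j => ε j = true).card = m then 1 else 0 := by
    intro ε
    rw [sgr_sum, sgr_prod]
    have e : ((2 * m : ℕ) : ℝ) - 2 * ((Finset.univ.filter fun j => ε j = true).card : ℝ) = 0 ↔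
        (Finset.univ.filter fun j => ε j = true).card = m := by
      push_cast
      constructor
      · intro h
        have : ((Finset.univ.filter fun j => ε j = true).card : ℝ) = m := by linarith
        exact_mod_cast this
      · intro h; rw [h]; ring
    by_cases hm : (Finset.univ.filter fun j => ε j = true).card = m
    · rw [if_pos (e.mpr hm), if_pos hm, hm, ← mul_pow]; simp
    · rw [if_neg (fun h => hm (e.mp h)), if_neg hm, zero_mul]
  rw [Finset.sum_congr rfl fun ε _ => h1 ε]
  have h2 : ∑ ε : Fin (2 * m) → Bool,
      (if (Finset.univ.filter fun j => ε j = true).card = m then (1 : ℝ) else 0) =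
      ∑ T : Finset (Fin (2 * m)), if T.card = m then (1 : ℝ) else 0 := by
    refine Finset.sum_nbij' (fun ε => Finset.univ.filter fun j => ε j = true)
      (fun T j => decide (j ∈ T)) (by simp) (by simp) ?_ ?_ (by simp)
    · intro ε _; ext j; simp
    · intro T _; ext j; simp
  rw [h2, ← Finset.sum_filter, Finset.sum_const, nsmul_eq_mul, mul_one]
  have h3 : (Finset.univ.filter fun T : Finset (Fin (2 * m)) => T.card = m) =
      Finset.powersetCard m Finset.univ := by
    ext T; simp [Finset.mem_powersetCard]
  rw [h3, Finset.card_powersetCard, Finset.card_univ, Fintype.card_fin]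

end Count

section Core
variable {κ : Type*} [Fintype κ] [DecidableEq κ]

theorem kron_list {α : Type*} (l : List α) (g : α → Matrix κ κ ℂ) :
    (l.map g).prod ⊗ₖ (l.map g).prod = (l.map (fun j => g j ⊗ₖ g j)).prod := by
  induction l with
  | nil => simp
  | cons a l ih => simp only [List.map_cons, List.prod_cons, mul_kronecker_mul, ih]

theorem list_eig {ι : Type*} [Fintype ι] [DecidableEq ι] {n : ℕ} (l : List (Fin n))
    (A : Fin n → Matrix ι ι ℂ) (Q : Matrix ι ι ℂ) (x : Fin n → ℂ) (h : ∀ j, A j * Q = x j • Q) :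
    (l.map A).prod * Q = (l.map x).prod • Q := by
  induction l with
  | nil => simp
  | cons a l ih =>
    simp only [List.map_cons, List.prod_cons]
    rw [mul_assoc, ih, mul_smul_comm, h, smul_smul, mul_comm]

theorem core (m : ℕ) (hm : 0 < m) (hcard : Fintype.card κ = 2 ^ m)
    (g : Fin (2 * m) → Matrix κ κ ℂ) (e : Matrix κ κ ℂ)
    (hg : ∀ j, (g j).IsHermitian) (he : e.IsHermitian)
    (gsq : ∀ j, g j * g j = 1) (esq : e * e = 1)
    (gg : ∀ j k, j ≠ k → g j * g k = -(g k * g j)) (eg : ∀ j, e * g j = -(g j * e))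
    (k : ℂ) (hk : k * k = (-1) ^ m) (hek : e = k • ((List.ofFn g).reverse.prod)) (t : ℝ) :
    (|t| < 1 → sig (e ⊗ₖ e + ∑ j, g j ⊗ₖ g j - (t : ℂ) • ((1 : Matrix κ κ ℂ) ⊗ₖ e)) =
      ((2 * m).choose m : ℤ)) ∧
    (1 < |t| → sig (e ⊗ₖ e + ∑ j, g j ⊗ₖ g j - (t : ℂ) • ((1 : Matrix κ κ ℂ) ⊗ₖ e)) = 0) := by
  set A : Fin (2 * m) → Matrix (κ × κ) (κ × κ) ℂ := fun j => g j ⊗ₖ g j with hA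
  have hh : ∀ j, (A j).IsHermitian := by
    intro j
    simp only [hA, IsHermitian, conjTranspose_kronecker, (hg j).eq]
  have hsq : ∀ j, A j * A j = 1 := by
    intro j
    simp only [hA, ← mul_kronecker_mul, gsq, one_kronecker_one]
  have nn : ∀ X Y : Matrix κ κ ℂ, (-X) ⊗ₖ (-Y) = X ⊗ₖ Y := by
    intro X Y; ext; simp [kroneckerMap_apply]
  have hc : ∀ i j, A i * A j = A j * A i := by
    intro i j
    by_cases h : i = j
    · rw [h]
    · simp only [hA, ← mul_kronecker_mul]
      rw [gg i j h, nn]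
  have hDA : ∀ j, (e ⊗ₖ e) * A j = A j * (e ⊗ₖ e) := by
    intro j
    simp only [hA, ← mul_kronecker_mul, eg, nn]
  have hGA : ∀ j, ((1 : Matrix κ κ ℂ) ⊗ₖ e) * A j = -(A j * ((1 : Matrix κ κ ℂ) ⊗ₖ e)) := by
    intro j
    simp only [hA, ← mul_kronecker_mul, eg, one_mul, mul_one]
    ext; simp [kroneckerMap_apply]
  have htr : ∀ ε, (Qp A ε).trace = 1 := by
    apply Qp_trace
    · rw [Fintype.card_prod, hcard, ← pow_add, two_mul]
    · intro i
      refine ⟨(g i * e) ⊗ₖ 1, (e * g i) ⊗ₖ 1, ?_, ?_⟩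
      · rw [← mul_kronecker_mul, mul_assoc, ← mul_assoc (g i), gsq, one_mul, esq, one_mul,
          one_kronecker_one]
      · intro j
        simp only [hA, ← mul_kronecker_mul, one_mul, mul_one]
        by_cases h : j = i
        · subst h
          have : g j * e * g j = - (g j * (g j * e)) := by rw [mul_assoc, eg, mul_neg]
          rw [this]
          ext; simp [kroneckerMap_apply, sgb]
        · have : g i * e * g j = g j * (g i * e) := by
            rw [mul_assoc, eg, mul_neg, ← mul_assoc, gg i j (Ne.symm h), neg_mul, neg_neg, mul_assoc]
          rw [this]
          simp [h, sgb]
  have hδ : ∀ ε, (e ⊗ₖ e) * Qp A ε = (((-1) ^ m * ∏ j, sgr (ε j) : ℝ) : ℂ) • Qp A ε := by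
    intro ε
    have h1 : e ⊗ₖ e = ((-1 : ℂ) ^ m) • ((List.finRange (2 * m)).reverse.map A).prod := by
      rw [hek, smul_kronecker, kronecker_smul, smul_smul, hk, List.ofFn_eq_map, ← List.map_reverse,
        kron_list]
    rw [h1, smul_mul_assoc, list_eig _ A _ (fun j => sgb (ε j)) (Qp_eig A hsq hc ε), smul_smul,
      List.map_reverse, List.prod_reverse, ← List.ofFn_eq_map, List.prod_ofFn]
    push_cast
    simp only [sgr_coe]
  have main := main_abs A hh hsq hc (by omega) (e ⊗ₖ e) ((1 : Matrix κ κ ℂ) ⊗ₖ e)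
    (by rw [conjTranspose_kronecker, he.eq]) (by rw [← mul_kronecker_mul, esq, one_kronecker_one])
    hDA (by rw [conjTranspose_kronecker, he.eq, conjTranspose_one])
    (by rw [← mul_kronecker_mul, esq, one_mul, one_kronecker_one])
    hGA (by rw [← mul_kronecker_mul, ← mul_kronecker_mul, one_mul, mul_one]) htr _ hδ t
  constructor
  · intro ht
    have h := main (1 - |t|) (by linarith) (fun ε => if ∑ j, sgr (ε j) = 0 then 1 else 0)
      (by intro ε; split_ifs <;> simp)
      (by
        intro ε
        have : ∑ j, sgr (!(ε j)) = - ∑ j, sgr (ε j) := by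
          rw [← Finset.sum_neg_distrib]
          refine Finset.sum_congr rfl fun j _ => ?_
          cases ε j <;> simp [sgr]
        simp only [this, neg_eq_zero])
      (by
        intro ε h
        refine ⟨?_, by linarith⟩
        by_contra h'
        simp [h'] at h)
      (by
        intro ε h
        have h' : ∑ j, sgr (ε j) ≠ 0 := by
          intro h'
          simp [h'] at h
        rw [sgr_sum] at h' ⊢
        set N := (Finset.univ.filter fun j => ε j = true).card
        apply Real.le_sqrt_of_sq_le
        have h2 : (1 : ℝ) ≤ ((m : ℝ) - N) ^ 2 := by
          have h3 : (m : ℤ) - N ≠ 0 := by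
            intro h4
            apply h'
            have h5 : ((m : ℤ) : ℝ) - ((N : ℤ) : ℝ) = 0 := by exact_mod_cast h4
            push_cast at h5 ⊢
            linarith
          have h4 : (1 : ℤ) ≤ ((m : ℤ) - N) ^ 2 := by
            have : 0 < ((m : ℤ) - N) ^ 2 := by positivity
            omega
          exact_mod_cast h4
        push_cast
        have h5 := abs_nonneg t
        nlinarith [sq_abs t, sq_nonneg t])
    rw [count_sum] at h
    exact_mod_cast h
  · intro ht
    have h := main (|t| - 1) (by linarith) (fun _ => 0) (by simp) (by simp) (by simp)
      (by
        intro ε _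
        apply Real.le_sqrt_of_sq_le
        rw [add_sub_cancel, sq_abs]
        nlinarith [sq_nonneg (∑ j, sgr (ε j))])
    simpa using h

end Core

section Rot
variable {κ : Type*} [Fintype κ] [DecidableEq κ]

theorem rot_unit {d : ℕ} (γ : Fin d → Matrix κ κ ℂ) (hherm : ∀ j, (γ j).IsHermitian)
    (hsq : ∀ j, γ j * γ j = 1) (hanti : ∀ j k, j ≠ k → γ j * γ k = -(γ k * γ j))
    (a : Fin d → ℝ) (ha : ∑ j, a j ^ 2 = 1) (u : Matrix κ κ ℂ) (hu : u = ∑ j, (a j : ℂ) • γ j) :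
    uᴴ = u ∧ u * u = 1 ∧ (∀ j, u * γ j * u = (2 * a j : ℂ) • u - γ j) ∧
      ∑ j, (u * γ j * u) ⊗ₖ (u * γ j * u) = ∑ j, γ j ⊗ₖ γ j := by
  have h1 : uᴴ = u := by
    rw [hu, conjTranspose_sum]
    refine Finset.sum_congr rfl fun j _ => ?_
    rw [conjTranspose_smul, (hherm j).eq]; simp
  have h2 : ∀ j, u * γ j = (2 * a j : ℂ) • (1 : Matrix κ κ ℂ) - γ j * u := by
    intro j
    have e1 : ∀ k, γ k * γ j = (if k = j then (2 : ℂ) else 0) • (1 : Matrix κ κ ℂ) - γ j * γ k := by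
      intro k
      by_cases h : k = j
      · subst h; rw [hsq, if_pos rfl]; module
      · rw [hanti k j h, if_neg h]; simp
    rw [hu, Finset.sum_mul, Finset.mul_sum]
    simp only [smul_mul_assoc, e1, smul_sub, mul_smul_comm, Finset.sum_sub_distrib, smul_smul]
    simp [mul_comm]
  have h3 : u * u = 1 := by
    have e1 : u * u = (2 : ℂ) • (1 : Matrix κ κ ℂ) - u * u := by
      conv_lhs => enter [2]; rw [hu]
      rw [Finset.mul_sum]
      simp only [mul_smul_comm, h2, smul_sub, Finset.sum_sub_distrib, smul_smul, ← Finset.sum_smul,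
        ← smul_mul_assoc, ← Finset.sum_mul, ← hu]
      congr 2
      have : ((∑ j, a j ^ 2 : ℝ) : ℂ) = 1 := by rw [ha]; simp
      push_cast at this
      refine Eq.trans ?_ ((congrArg (fun x : ℂ => 2 * x) this).trans (mul_one 2))
      rw [Finset.mul_sum]
      exact Finset.sum_congr rfl fun j _ => by ring
    have e2 : (2 : ℂ) • (u * u) = (2 : ℂ) • (1 : Matrix κ κ ℂ) := by
      rw [two_smul]; nth_rewrite 1 [e1]; abel
    exact smul_right_injective _ (two_ne_zero) e2
  have h4 : ∀ j, u * γ j * u = (2 * a j : ℂ) • u - γ j := by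
    intro j
    rw [h2, sub_mul, smul_mul_assoc, one_mul, mul_assoc, h3, mul_one]
  refine ⟨h1, h3, h4, ?_⟩
  have e1 : ∀ j, (u * γ j * u) ⊗ₖ (u * γ j * u) = (4 * (a j : ℂ) ^ 2) • (u ⊗ₖ u)
      - (2 : ℂ) • (u ⊗ₖ ((a j : ℂ) • γ j)) - (2 : ℂ) • (((a j : ℂ) • γ j) ⊗ₖ u) + γ j ⊗ₖ γ j := by
    intro j
    rw [h4]
    ext x y
    simp [kroneckerMap_apply]
    ring
  have e2 : ∑ j, u ⊗ₖ ((a j : ℂ) • γ j) = u ⊗ₖ u := by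
    ext x y
    conv_rhs => rw [kroneckerMap_apply]; enter [2]; rw [hu]
    simp [kroneckerMap_apply, Matrix.sum_apply, Finset.mul_sum]
  have e3 : ∑ j, ((a j : ℂ) • γ j) ⊗ₖ u = u ⊗ₖ u := by
    ext x y
    conv_rhs => rw [kroneckerMap_apply]; enter [1]; rw [hu]
    simp [kroneckerMap_apply, Matrix.sum_apply, Finset.sum_mul]
  have e4 : ∑ j, (4 * (a j : ℂ) ^ 2) = 4 := by
    have : ((∑ j, a j ^ 2 : ℝ) : ℂ) = 1 := by rw [ha]; simp
    push_cast at this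
    rw [← Finset.mul_sum, this, mul_one]
  simp only [e1]
  rw [Finset.sum_add_distrib, Finset.sum_sub_distrib, Finset.sum_sub_distrib, ← Finset.smul_sum,
    ← Finset.smul_sum, e2, e3, ← Finset.sum_smul, e4]
  module

theorem rot {d : ℕ} (γ : Fin d → Matrix κ κ ℂ) (hherm : ∀ j, (γ j).IsHermitian)
    (hsq : ∀ j, γ j * γ j = 1) (hanti : ∀ j k, j ≠ k → γ j * γ k = -(γ k * γ j))
    (lam : Fin d → ℝ) (p : Fin d) (ρ : ℝ) (hρ : 0 ≤ ρ) (hl : ∑ j, lam j ^ 2 = ρ ^ 2) :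
    ∃ (t : ℝ) (u : Matrix κ κ ℂ), |t| = ρ ∧ uᴴ = u ∧ u * u = 1 ∧
      ∑ j, (u * γ j * u) ⊗ₖ (u * γ j * u) = ∑ j, γ j ⊗ₖ γ j ∧
      ∑ j, (lam j : ℂ) • γ j = (t : ℂ) • (u * γ p * u) := by
  have hp : lam p ^ 2 ≤ ρ ^ 2 := by
    rw [← hl]
    exact Finset.single_le_sum (f := fun j => lam j ^ 2) (fun j _ => sq_nonneg _) (Finset.mem_univ p)
  have hp' := abs_le.mp (abs_le_of_sq_le_sq hp hρ)
  by_cases h : lam p = -ρ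
  · refine ⟨-ρ, 1, by rw [abs_neg, abs_of_nonneg hρ], by simp, by simp, by simp, ?_⟩
    have h0 : ∀ j, j ≠ p → lam j = 0 := by
      intro j hj
      rw [← Finset.add_sum_erase _ _ (Finset.mem_univ p), h, neg_sq] at hl
      have h2 : ∑ j ∈ Finset.univ.erase p, lam j ^ 2 = 0 := by linarith
      rw [Finset.sum_eq_zero_iff_of_nonneg (fun j _ => sq_nonneg _)] at h2
      exact pow_eq_zero_iff (two_ne_zero) |>.mp (h2 j (by simp [hj]))
    rw [Finset.sum_eq_single p (fun j _ hj => by simp [h0 j hj]) (by simp), h]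
    simp
  · have hpos : 0 < ρ + lam p := by
      rcases lt_or_eq_of_le hp'.1 with h' | h'
      · linarith
      · exact absurd h'.symm h
    have hρ0 : 0 < ρ := by linarith [hp'.2]
    set q := √(2 * ρ * (ρ + lam p)) with hq
    have hq2 : q ^ 2 = 2 * ρ * (ρ + lam p) := Real.sq_sqrt (by positivity)
    have hq0 : 0 < q := Real.sqrt_pos.mpr (by positivity)
    set a : Fin d → ℝ := fun j => (lam j + if j = p then ρ else 0) / q with ha
    have ha1 : ∑ j, a j ^ 2 = 1 := by
      have e : ∀ j, a j ^ 2 = (lam j ^ 2 + (if j = p then 2 * ρ * lam j + ρ ^ 2 else 0)) / q ^ 2 := by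
        intro j
        simp only [ha, div_pow]
        congr 1
        split_ifs <;> ring
      simp only [e, ← Finset.sum_div, Finset.sum_add_distrib, hl, Finset.sum_ite_eq',
        Finset.mem_univ, if_true]
      rw [div_eq_one_iff_eq (by positivity), hq2]; ring
    obtain ⟨h1, h2, h3, h4⟩ := rot_unit γ hherm hsq hanti a ha1 _ rfl
    refine ⟨ρ, _, abs_of_nonneg hρ, h1, h2, h4, ?_⟩
    rw [h3, smul_sub, smul_smul, Finset.smul_sum]
    have e : ∀ j, ((ρ : ℂ) * (2 * (a p : ℂ))) • (a j : ℂ) • γ j =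
        (lam j : ℂ) • γ j + (if j = p then (ρ : ℂ) else 0) • γ j := by
      intro j
      have e1 : ρ * (2 * a p) * a j = lam j + if j = p then ρ else 0 := by
        simp only [ha, if_true]
        have : ρ * (2 * ((lam p + ρ) / q)) * ((lam j + if j = p then ρ else 0) / q) =
          (2 * ρ * (ρ + lam p)) * (lam j + if j = p then ρ else 0) / q ^ 2 := by
          field_simp; ring
        rw [this, ← hq2]
        field_simp
      rw [smul_smul, ← add_smul]
      congr 1
      have e2 := congrArg (fun x : ℝ => (x : ℂ)) e1
      push_cast at e2
      rw [e2]
      split_ifs <;> simp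
    simp only [e, Finset.sum_add_distrib]
    simp

theorem conj_list {α : Type*} (l : List α) (g : α → Matrix κ κ ℂ) (u : Matrix κ κ ℂ)
    (hu : u * u = 1) : (l.map (fun j => u * g j * u)).prod = u * (l.map g).prod * u := by
  induction l with
  | nil => simp [hu]
  | cons a l ih =>
    simp only [List.map_cons, List.prod_cons, ih]
    calc u * g a * u * (u * (l.map g).prod * u) = u * g a * (u * u) * (l.map g).prod * u := by
          simp only [mul_assoc]
      _ = _ := by rw [hu, mul_one, mul_assoc u]

theorem core2 (m : ℕ) (hm : 0 < m) (hcard : Fintype.card κ = 2 ^ m)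
    (γ : Fin (2 * m + 1) → Matrix κ κ ℂ) (hherm : ∀ j, (γ j).IsHermitian)
    (hsq : ∀ j, γ j * γ j = 1) (hanti : ∀ j k, j ≠ k → γ j * γ k = -(γ k * γ j))
    (k : ℂ) (hk : k * k = (-1) ^ m)
    (hek : γ (Fin.last _) = k • ((List.ofFn fun j : Fin (2 * m) => γ j.castSucc).reverse.prod))
    (lam : EuclideanSpace ℝ (Fin (2 * m + 1))) :
    (‖lam‖ < 1 → sig (∑ j, ((γ j - (lam j : ℂ) • 1) ⊗ₖ γ j)) = ((2 * m).choose m : ℤ)) ∧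
    (1 < ‖lam‖ → sig (∑ j, ((γ j - (lam j : ℂ) • 1) ⊗ₖ γ j)) = 0) := by
  obtain ⟨t, u, ht, hu, huu, hsum, hlam⟩ := rot γ hherm hsq hanti (fun j => lam j) (Fin.last _) ‖lam‖
    (norm_nonneg _) (by rw [EuclideanSpace.real_norm_sq_eq])
  set γ' : Fin (2 * m + 1) → Matrix κ κ ℂ := fun j => u * γ j * u with hγ'
  have mul' : ∀ i j, γ' i * γ' j = u * (γ i * γ j) * u := by
    intro i j
    calc u * γ i * u * (u * γ j * u) = u * γ i * (u * u) * γ j * u := by simp only [mul_assoc]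
      _ = _ := by rw [huu, mul_one, mul_assoc u]
  have sq' : ∀ j, γ' j * γ' j = 1 := by intro j; rw [mul', hsq, mul_one, huu]
  have anti' : ∀ i j, i ≠ j → γ' i * γ' j = -(γ' j * γ' i) := by
    intro i j h; rw [mul', mul', hanti i j h, mul_neg, neg_mul]
  have herm' : ∀ j, (γ' j).IsHermitian := by
    intro j
    simp only [IsHermitian, hγ', conjTranspose_mul, hu, (hherm j).eq, mul_assoc]
  have hL : ∑ j, ((γ j - (lam j : ℂ) • 1) ⊗ₖ γ j) =
      γ' (Fin.last _) ⊗ₖ γ' (Fin.last _) + ∑ j : Fin (2 * m), γ' j.castSucc ⊗ₖ γ' j.castSucc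
        - (t : ℂ) • ((1 : Matrix κ κ ℂ) ⊗ₖ γ' (Fin.last _)) := by
    have e1 : γ' (Fin.last _) ⊗ₖ γ' (Fin.last _) +
        ∑ j : Fin (2 * m), γ' j.castSucc ⊗ₖ γ' j.castSucc = ∑ j, γ j ⊗ₖ γ j := by
      rw [← hsum, Fin.sum_univ_castSucc, add_comm]
    rw [e1, ← kronecker_smul, ← hlam]
    ext x y
    simp only [Matrix.sum_apply, Matrix.sub_apply, kroneckerMap_apply, Matrix.smul_apply,
      smul_eq_mul, Finset.mul_sum, ← Finset.sum_sub_distrib]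
    exact Finset.sum_congr rfl fun j _ => by ring
  rw [hL, ← ht]
  refine core m hm hcard (fun j => γ' j.castSucc) (γ' (Fin.last _)) (fun j => herm' _) (herm' _)
    (fun j => sq' _) (sq' _) (fun i j h => anti' _ _ ?_) (fun j => anti' _ _ ?_) k hk ?_ t
  · exact fun h' => h (Fin.castSucc_injective _ h')
  · exact (Fin.castSucc_lt_last j).ne'
  · simp only [hγ']
    rw [List.ofFn_eq_map, ← List.map_reverse, conj_list _ (fun j : Fin (2 * m) => γ j.castSucc) u huu,
      hek, List.ofFn_eq_map, ← List.map_reverse, mul_smul_comm, smul_mul_assoc]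
end Rot

end CliffordSig

theorem signature_odd_clifford_rep
    {d : ℕ} (hd : Odd d) (hd3 : 3 ≤ d)
    (γ : Fin d → Matrix (Fin (2 ^ ((d - 1) / 2))) (Fin (2 ^ ((d - 1) / 2))) ℂ)
    (hherm : ∀ j, (γ j).IsHermitian)
    (hsq : ∀ j, γ j * γ j = 1)
    (hanti : ∀ j k, j ≠ k → γ j * γ k = -(γ k * γ j))
    (hsign : γ ⟨d - 1, by omega⟩ =
      (Complex.I ^ ((d + 3) / 2)) •
        ((List.ofFn fun j : Fin (d - 1) => γ (Fin.castLE (by omega) j)).reverse.prod))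
    (lam : EuclideanSpace ℝ (Fin d)) :
    (‖lam‖ < 1 →
      sig (∑ j, ((γ j - (lam j : ℂ) • 1) ⊗ₖ γ j)) = ((d - 1).choose ((d - 1) / 2) : ℤ)) ∧
    (1 < ‖lam‖ → sig (∑ j, ((γ j - (lam j : ℂ) • 1) ⊗ₖ γ j)) = 0) := by
  obtain ⟨m, rfl⟩ := hd
  have hm : (2 * m + 1 - 1) / 2 = m := by omega
  have hk : (Complex.I ^ ((2 * m + 1 + 3) / 2)) * (Complex.I ^ ((2 * m + 1 + 3) / 2)) =
      (-1 : ℂ) ^ m := by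
    have : (2 * m + 1 + 3) / 2 = m + 2 := by omega
    rw [this, ← mul_pow, Complex.I_mul_I, pow_add]; norm_num
  have h := core2 m (by omega) (by rw [Fintype.card_fin, hm]) γ hherm hsq hanti _ hk hsign lam
  have h2 : (2 * m + 1 - 1).choose ((2 * m + 1 - 1) / 2) = (2 * m).choose m := by
    rw [hm]; rfl
  rw [h2]
  exact h
end
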